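/- arXiv:2501.00419 — 3 statements merged into one kernel-verified Lean document; each statement's English description precedes it below -/
import Mathlib

section
/- For every vertex v of G11 of degree at most 2, the graph G11 − N[v] is connected; similarly for G15. -/
open SimpleGraph

/-- The graph `G₁₁` of the paper, with vertices `0,…,10` standing for `1,…,11`. -/
def G11graph : SimpleGraph (Fin 11) :=
  SimpleGraph.fromRel (fun u v => ((u.val, v.val) ∈
    [(0,1),(0,10),(1,10),(1,2),(2,3),(2,8),(3,4),(3,9),(4,5),(5,6),(6,7),(7,8),
     (8,9),(9,10)] : Prop))

/-- The graph `G₁₅` of the paper, with vertices `0,…,14` standing for `1,…,15`. -/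
def G15graph : SimpleGraph (Fin 15) :=
  SimpleGraph.fromRel (fun u v => ((u.val, v.val) ∈
    [(0,1),(0,14),(1,14),(1,2),(2,3),(2,12),(3,11),(11,4),(3,13),(4,5),(4,9),
     (5,6),(5,10),(6,7),(6,8),(7,8),(8,9),(9,10),(10,12),(12,13),(13,14)] : Prop))

noncomputable instance : DecidableRel G11graph.Adj := Classical.decRel _
noncomputable instance : DecidableRel G15graph.Adj := Classical.decRel _

/-- The closed neighbourhood `N[v]` of a vertex. -/
def closedNbhdV {V : Type*} (G : SimpleGraph V) (v : V) : Set V :=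
  {w | w = v ∨ G.Adj v w}

/-- A vertex set with a parent map inside it, leading every vertex to the root `r`,
induces a connected graph. -/
theorem connected_of_parent {V : Type*} (G : SimpleGraph V) (s : Set V) (r : V) (hr : r ∈ s)
    (f : V → V) (k : ℕ)
    (hf : ∀ w, w ∈ s → f w ∈ s ∧ (f w = w ∨ G.Adj w (f w)) ∧ f^[k] w = r) :
    (G.induce s).Connected := by
  have key : ∀ (m : ℕ) (w : V) (hw : w ∈ s), f^[m] w = r →
      (G.induce s).Reachable ⟨w, hw⟩ ⟨r, hr⟩ := by
    intro m
    induction m with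
    | zero =>
      intro w hw h
      have h' : w = r := h
      subst h'
      exact Reachable.refl _
    | succ m ih =>
      intro w hw h
      obtain ⟨h1, h2, -⟩ := hf w hw
      have h3 := ih (f w) h1 h
      rcases h2 with h2 | h2
      · have e : (⟨f w, h1⟩ : s) = ⟨w, hw⟩ := Subtype.ext h2
        rwa [e] at h3
      · have a : (G.induce s).Adj ⟨w, hw⟩ ⟨f w, h1⟩ := h2
        exact a.reachable.trans h3
  have : Nonempty s := ⟨⟨r, hr⟩⟩
  refine ⟨fun a b => ?_⟩
  exact (key k a.1 a.2 (hf a.1 a.2).2.2).trans (key k b.1 b.2 (hf b.1 b.2).2.2).symm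

/-- Three distinct neighbours force degree greater than two. -/
theorem degree_gt_two {V : Type*} [Fintype V] [DecidableEq V] (G : SimpleGraph V)
    [DecidableRel G.Adj] (v a b c : V)
    (h : (G.Adj v a ∧ G.Adj v b ∧ G.Adj v c) ∧ a ≠ b ∧ a ≠ c ∧ b ≠ c) : ¬ G.degree v ≤ 2 := by
  obtain ⟨⟨ha, hb, hc⟩, hab, hac, hbc⟩ := h
  have h3 : ({a, b, c} : Finset V).card = 3 := Finset.card_eq_three.2 ⟨a, b, c, hab, hac, hbc, rfl⟩
  have hs : ({a, b, c} : Finset V) ⊆ G.neighborFinset v := by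
    intro x hx
    simp only [Finset.mem_insert, Finset.mem_singleton] at hx
    rw [mem_neighborFinset]
    rcases hx with rfl | rfl | rfl <;> assumption
  have := Finset.card_le_card hs
  rw [card_neighborFinset_eq_degree] at this
  omega

/-- For each vertex `v` of degree at most `2`, `G₁₁ − N[v]` is connected; similarly for `G₁₅`. -/
theorem stmt14 :
    (∀ v : Fin 11, G11graph.degree v ≤ 2 →
      (G11graph.induce (closedNbhdV G11graph v)ᶜ).Connected) ∧
    (∀ v : Fin 15, G15graph.degree v ≤ 2 →
      (G15graph.induce (closedNbhdV G15graph v)ᶜ).Connected) := by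
  constructor
  · intro v hv
    fin_cases v
    · refine connected_of_parent _ _ 2 ?_ ![2, 2, 2, 2, 3, 4, 5, 8, 2, 3, 2] 6 ?_
      · simp only [closedNbhdV, G11graph, fromRel_adj, Set.mem_compl_iff, Set.mem_setOf_eq]; decide
      · simp only [closedNbhdV, G11graph, fromRel_adj, Set.mem_compl_iff, Set.mem_setOf_eq]; decide
    · exact absurd hv (degree_gt_two _ _ 0 10 2 (by simp only [G11graph, fromRel_adj]; decide))
    · exact absurd hv (degree_gt_two _ _ 1 3 8 (by simp only [G11graph, fromRel_adj]; decide))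
    · exact absurd hv (degree_gt_two _ _ 2 4 9 (by simp only [G11graph, fromRel_adj]; decide))
    · refine connected_of_parent _ _ 2 ?_ ![1, 2, 2, 2, 2, 2, 7, 8, 2, 8, 1] 6 ?_
      · simp only [closedNbhdV, G11graph, fromRel_adj, Set.mem_compl_iff, Set.mem_setOf_eq]; decide
      · simp only [closedNbhdV, G11graph, fromRel_adj, Set.mem_compl_iff, Set.mem_setOf_eq]; decide
    · refine connected_of_parent _ _ 2 ?_ ![1, 2, 2, 2, 2, 2, 2, 8, 2, 8, 1] 6 ?_
      · simp only [closedNbhdV, G11graph, fromRel_adj, Set.mem_compl_iff, Set.mem_setOf_eq]; decide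
      · simp only [closedNbhdV, G11graph, fromRel_adj, Set.mem_compl_iff, Set.mem_setOf_eq]; decide
    · refine connected_of_parent _ _ 2 ?_ ![1, 2, 2, 2, 3, 2, 2, 2, 2, 8, 1] 6 ?_
      · simp only [closedNbhdV, G11graph, fromRel_adj, Set.mem_compl_iff, Set.mem_setOf_eq]; decide
      · simp only [closedNbhdV, G11graph, fromRel_adj, Set.mem_compl_iff, Set.mem_setOf_eq]; decide
    · refine connected_of_parent _ _ 2 ?_ ![1, 2, 2, 2, 3, 4, 2, 2, 2, 3, 1] 6 ?_
      · simp only [closedNbhdV, G11graph, fromRel_adj, Set.mem_compl_iff, Set.mem_setOf_eq]; decide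
      · simp only [closedNbhdV, G11graph, fromRel_adj, Set.mem_compl_iff, Set.mem_setOf_eq]; decide
    · exact absurd hv (degree_gt_two _ _ 2 7 9 (by simp only [G11graph, fromRel_adj]; decide))
    · exact absurd hv (degree_gt_two _ _ 3 8 10 (by simp only [G11graph, fromRel_adj]; decide))
    · exact absurd hv (degree_gt_two _ _ 0 1 9 (by simp only [G11graph, fromRel_adj]; decide))
  · intro v hv
    fin_cases v
    · refine connected_of_parent _ _ 2 ?_ ![2, 2, 2, 2, 11, 4, 5, 6, 9, 4, 12, 3, 2, 3, 2] 6 ?_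
      · simp only [closedNbhdV, G15graph, fromRel_adj, Set.mem_compl_iff, Set.mem_setOf_eq]; decide
      · simp only [closedNbhdV, G15graph, fromRel_adj, Set.mem_compl_iff, Set.mem_setOf_eq]; decide
    · exact absurd hv (degree_gt_two _ _ 0 14 2 (by simp only [G15graph, fromRel_adj]; decide))
    · exact absurd hv (degree_gt_two _ _ 1 3 12 (by simp only [G15graph, fromRel_adj]; decide))
    · exact absurd hv (degree_gt_two _ _ 2 11 13 (by simp only [G15graph, fromRel_adj]; decide))
    · exact absurd hv (degree_gt_two _ _ 11 5 9 (by simp only [G15graph, fromRel_adj]; decide))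
    · exact absurd hv (degree_gt_two _ _ 4 6 10 (by simp only [G15graph, fromRel_adj]; decide))
    · exact absurd hv (degree_gt_two _ _ 5 7 8 (by simp only [G15graph, fromRel_adj]; decide))
    · refine connected_of_parent _ _ 2 ?_ ![1, 2, 2, 2, 11, 4, 2, 2, 2, 4, 12, 3, 2, 3, 1] 6 ?_
      · simp only [closedNbhdV, G15graph, fromRel_adj, Set.mem_compl_iff, Set.mem_setOf_eq]; decide
      · simp only [closedNbhdV, G15graph, fromRel_adj, Set.mem_compl_iff, Set.mem_setOf_eq]; decide
    · exact absurd hv (degree_gt_two _ _ 6 7 9 (by simp only [G15graph, fromRel_adj]; decide))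
    · exact absurd hv (degree_gt_two _ _ 4 8 10 (by simp only [G15graph, fromRel_adj]; decide))
    · exact absurd hv (degree_gt_two _ _ 5 9 12 (by simp only [G15graph, fromRel_adj]; decide))
    · refine connected_of_parent _ _ 2 ?_ ![1, 2, 2, 2, 2, 10, 5, 6, 9, 10, 12, 2, 2, 12, 1] 6 ?_
      · simp only [closedNbhdV, G15graph, fromRel_adj, Set.mem_compl_iff, Set.mem_setOf_eq]; decide
      · simp only [closedNbhdV, G15graph, fromRel_adj, Set.mem_compl_iff, Set.mem_setOf_eq]; decide
    · exact absurd hv (degree_gt_two _ _ 2 10 13 (by simp only [G15graph, fromRel_adj]; decide))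
    · exact absurd hv (degree_gt_two _ _ 3 12 14 (by simp only [G15graph, fromRel_adj]; decide))
    · exact absurd hv (degree_gt_two _ _ 0 1 13 (by simp only [G15graph, fromRel_adj]; decide))
end

section
/- If G is a connected subcubic graph on n ≤ 7 vertices that has no induced 6-cycle and is not isomorphic to P3, C3, C7, or any of the six graphs G_{7,1},…,G_{7,6}, then ι(G, P3) ≤ n/4 (equivalently, ι(G,P3) ≤ 1 when n = 7). -/
open SimpleGraph

/-- `G` contains a copy of the 3-vertex path as a (not necessarily induced) subgraph. -/
def containsP3 {V : Type*} (G : SimpleGraph V) : Prop :=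
  ∃ f : Fin 3 → V, Function.Injective f ∧
    ∀ a b, (SimpleGraph.pathGraph 3).Adj a b → G.Adj (f a) (f b)

/-- The closed neighbourhood `N[D]` of a set of vertices `D`. -/
def closedNbhd {V : Type*} (G : SimpleGraph V) (D : Set V) : Set V :=
  {v | v ∈ D ∨ ∃ d ∈ D, G.Adj d v}

/-- `D` is a `P3`-isolating set of `G`: `G - N[D]` contains no copy of `P3`. -/
def IsP3Isolating {V : Type*} (G : SimpleGraph V) (D : Set V) : Prop :=
  ¬ containsP3 (G.induce (closedNbhd G D)ᶜ)

/-- The `P3`-isolation number `ι(G, P3)`. -/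
noncomputable def iotaP3 {V : Type*} (G : SimpleGraph V) : ℕ :=
  sInf {n | ∃ D : Finset V, D.card = n ∧ IsP3Isolating G ↑D}

/-- `G` has an induced 6-cycle. -/
def hasInducedC6 {V : Type*} (G : SimpleGraph V) : Prop :=
  ∃ f : Fin 6 → V, Function.Injective f ∧
    ∀ a b, G.Adj (f a) (f b) ↔ (SimpleGraph.cycleGraph 6).Adj a b

/-- The graph `G₇,₁` of the paper, vertices `0,…,6` standing for `1,…,7`. -/
def G71graph : SimpleGraph (Fin 7) :=
  SimpleGraph.fromRel (fun u v => ((u.val, v.val) ∈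
    [(0,1),(1,2),(2,3),(2,4),(3,4),(4,5),(5,0),(0,6)] : Prop))

/-- The graph `G₇,₂` of the paper. -/
def G72graph : SimpleGraph (Fin 7) :=
  SimpleGraph.fromRel (fun u v => ((u.val, v.val) ∈
    [(0,1),(1,2),(2,3),(2,4),(3,4),(4,5),(5,0),(0,6),(1,6)] : Prop))

/-- The graph `G₇,₃` of the paper. -/
def G73graph : SimpleGraph (Fin 7) :=
  SimpleGraph.fromRel (fun u v => ((u.val, v.val) ∈
    [(0,1),(1,2),(2,3),(2,4),(3,4),(4,5),(5,0),(0,6),(3,6)] : Prop))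

/-- The graph `G₇,₄` of the paper. -/
def G74graph : SimpleGraph (Fin 7) :=
  SimpleGraph.fromRel (fun u v => ((u.val, v.val) ∈
    [(0,1),(1,2),(2,3),(2,4),(3,4),(4,5),(5,0),(0,6),(1,6),(3,6)] : Prop))

/-- The graph `G₇,₅` of the paper. -/
def G75graph : SimpleGraph (Fin 7) :=
  SimpleGraph.fromRel (fun u v => ((u.val, v.val) ∈
    [(0,1),(0,6),(1,2),(1,6),(2,3),(2,4),(3,5),(4,5),(5,6)] : Prop))

/-- The graph `G₇,₆` of the paper. -/
def G76graph : SimpleGraph (Fin 7) :=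
  SimpleGraph.fromRel (fun u v => ((u.val, v.val) ∈
    [(0,1),(0,6),(1,2),(1,6),(2,3),(2,4),(3,4),(3,5),(4,5),(5,6)] : Prop))


namespace Stmt16Aux

/-- All numbers below `n` satisfy `p`. -/
def allN (n : ℕ) (p : ℕ → Bool) : Bool := Nat.rec true (fun k r => p k && r) n

/-- Some number below `n` satisfies `p`. -/
def anyN (n : ℕ) (p : ℕ → Bool) : Bool := Nat.rec false (fun k r => p k || r) n

/-- How many numbers below `n` satisfy `p`. -/
def countN (n : ℕ) (p : ℕ → Bool) : ℕ := Nat.rec 0 (fun k r => Nat.add (cond (p k) 1 0) r) n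

/-- The bit of index `k` of the number `m`. -/
def bit (m k : ℕ) : Bool := Nat.beq (Nat.land (Nat.shiftRight m k) 1) 1

/-- The octal digit of index `i` of the number `s`. -/
def dig (s i : ℕ) : ℕ := Nat.land (Nat.shiftRight s (Nat.mul 3 i)) 7

/-- Index of the bit that stores the entry `(i, j)`. -/
def idx (T i j : ℕ) : ℕ := Nat.land (Nat.shiftRight T (Nat.mul 4 (Nat.add (Nat.mul 7 i) j))) 15

/-- Adjacency matrix stored in the bits of `m` with the layout `T`. -/
def mat (T m i j : ℕ) : Bool := bit m (idx T i j)

/-- Adjacency matrix stored row by row in the bits of `m`. -/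
def adjM (m i j : ℕ) : Bool := bit m (Nat.add (Nat.mul 7 i) j)

lemma allN_iff (n : ℕ) (p : ℕ → Bool) : allN n p = true ↔ ∀ k < n, p k = true := by
  induction n with
  | zero => simp [allN]
  | succ n ih =>
    have : allN (n + 1) p = (p n && allN n p) := rfl
    rw [this, Bool.and_eq_true, ih]
    constructor
    · rintro ⟨h1, h2⟩ k hk
      rcases Nat.lt_succ_iff_lt_or_eq.mp hk with h | h
      · exact h2 k h
      · rw [h]; exact h1
    · exact fun h => ⟨h n (by omega), fun k hk => h k (by omega)⟩

lemma anyN_iff (n : ℕ) (p : ℕ → Bool) : anyN n p = true ↔ ∃ k < n, p k = true := by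
  induction n with
  | zero => simp [anyN]
  | succ n ih =>
    have : anyN (n + 1) p = (p n || anyN n p) := rfl
    rw [this, Bool.or_eq_true, ih]
    constructor
    · rintro (h | ⟨k, hk, h⟩)
      · exact ⟨n, by omega, h⟩
      · exact ⟨k, by omega, h⟩
    · rintro ⟨k, hk, h⟩
      rcases Nat.lt_succ_iff_lt_or_eq.mp hk with h' | h'
      · exact Or.inr ⟨k, h', h⟩
      · rw [h'] at h; exact Or.inl h

lemma countN_eq (n : ℕ) (p : ℕ → Bool) :
    countN n p = ((Finset.range n).filter (fun k => p k = true)).card := by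
  induction n with
  | zero => simp [countN]
  | succ n ih =>
    have : countN (n + 1) p = (cond (p n) 1 0) + countN n p := rfl
    rw [this, ih, Finset.range_add_one, Finset.filter_insert]
    cases h : p n
    · simp
    · simp [add_comm]

/-- Adjacency matrix given by a list of edges. -/
def edgeB (L : List (ℕ × ℕ)) (i j : Fin 7) : Bool :=
  !(i.val == j.val) && (L.any (fun p => p.1 == i.val && p.2 == j.val) ||
    L.any (fun p => p.1 == j.val && p.2 == i.val))

/-- The vertex `v` alone is isolating. -/
def isoB (n : ℕ) (A : ℕ → ℕ → Bool) (v : ℕ) : Bool :=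
  allN n fun y => A v y || Nat.beq v y ||
    Nat.ble (countN n fun x => A y x && (!(A v x) && !(Nat.beq v x))) 1

/-- No edge leaves the set `S`. -/
def cutB (n : ℕ) (A : ℕ → ℕ → Bool) (S : ℕ → Bool) : Bool :=
  allN n fun i => !(S i) || allN n fun j => S j || !(A i j)

/-- Some degree exceeds `d`. -/
def bigB (n : ℕ) (A : ℕ → ℕ → Bool) (d : ℕ) : Bool :=
  anyN n fun i => Nat.ble (Nat.succ d) (countN n (A i))

/-- The map `s` embeds `H` as an induced subgraph. -/
def embB (m n : ℕ) (A H : ℕ → ℕ → Bool) (s : ℕ → ℕ) : Bool :=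
  allN m fun i => Nat.ble (Nat.succ (s i)) n && allN m fun j =>
    (cond (H i j) (A (s i) (s j)) (!(A (s i) (s j)))) && (Nat.beq i j || !(Nat.beq (s i) (s j)))

lemma c6_iff (i j : Fin 6) : adjM 594895078050 i j = true ↔
    (SimpleGraph.cycleGraph 6).Adj i j := by
  revert i j; decide

lemma c7_iff (i j : Fin 7) : adjM 147895093461698 i j = true ↔
    (SimpleGraph.cycleGraph 7).Adj i j := by
  revert i j; decide

lemma edgeB_iff (L : List (ℕ × ℕ)) (i j : Fin 7) : edgeB L i j = true ↔
    (SimpleGraph.fromRel (fun u v : Fin 7 => ((u.val, v.val) ∈ L : Prop))).Adj i j := by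
  simp only [edgeB, SimpleGraph.fromRel_adj, Bool.and_eq_true, Bool.or_eq_true, List.any_eq_true,
    Bool.not_eq_true', beq_eq_false_iff_ne, beq_iff_eq, Prod.exists]
  constructor
  · rintro ⟨h, h'⟩
    refine ⟨fun hh => h (by rw [hh]), ?_⟩
    rcases h' with ⟨a, b, h1, h2, h3⟩ | ⟨a, b, h1, h2, h3⟩
    · left; subst h2; subst h3; exact h1
    · right; subst h2; subst h3; exact h1
  · rintro ⟨h, h'⟩
    refine ⟨fun hh => h (Fin.ext hh), ?_⟩
    rcases h' with h' | h'
    · left; exact ⟨_, _, h', rfl, rfl⟩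
    · right; exact ⟨_, _, h', rfl, rfl⟩

lemma g1_iff (i j : Fin 7) : adjM 4994015593186 i j = true ↔ G71graph.Adj i j := by
  rw [G71graph, ← edgeB_iff]
  revert i j; decide

lemma g2_iff (i j : Fin 7) : adjM 13790108623586 i j = true ↔ G72graph.Adj i j := by
  rw [G72graph, ← edgeB_iff]
  revert i j; decide

lemma g3_iff (i j : Fin 7) : adjM 40178521899746 i j = true ↔ G73graph.Adj i j := by
  rw [G73graph, ← edgeB_iff]
  revert i j; decide

lemma g4_iff (i j : Fin 7) : adjM 48974614930146 i j = true ↔ G74graph.Adj i j := by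
  rw [G74graph, ← edgeB_iff]
  revert i j; decide

lemma g5_iff (i j : Fin 7) : adjM 156965024473794 i j = true ↔ G75graph.Adj i j := by
  rw [G75graph, ← edgeB_iff]
  revert i j; decide

lemma g6_iff (i j : Fin 7) : adjM 156967205511874 i j = true ↔ G76graph.Adj i j := by
  rw [G76graph, ← edgeB_iff]
  revert i j; decide

section Sound

variable {V : Type*} {n : ℕ} {G : SimpleGraph V} {e : Fin n ≃ V} {A : ℕ → ℕ → Bool}

lemma beqF {a b : ℕ} (h : a ≠ b) : Nat.beq a b = false := by
  rw [← Bool.not_eq_true, Nat.beq_eq]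
  exact h

lemma isoB_sound (hA : ∀ i j : Fin n, A i j = true ↔ G.Adj (e i) (e j)) {v : Fin n}
    (h : isoB n A v = true) : IsP3Isolating G (({e v} : Finset V) : Set V) := by
  rintro ⟨f, hf, hadj⟩
  have h01 : G.Adj (f 1) (f 0) := hadj 1 0 (by simp [SimpleGraph.pathGraph_adj])
  have h12 : G.Adj (f 1) (f 2) := hadj 1 2 (by simp [SimpleGraph.pathGraph_adj])
  have hout : ∀ k, ¬ G.Adj (e v) (f k) ∧ (f k : V) ≠ e v := by
    intro k
    have := (f k).2
    simp only [closedNbhd, Set.mem_compl_iff, Set.mem_ofPred_eq, Finset.coe_singleton,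
      Set.mem_singleton_iff, exists_eq_left, not_or] at this
    exact ⟨this.2, this.1⟩
  obtain ⟨x, hx⟩ := e.surjective (f 0)
  obtain ⟨y, hy⟩ := e.surjective (f 1)
  obtain ⟨z, hz⟩ := e.surjective (f 2)
  have nA : ∀ w k, e w = f k → A v w = false ∧ v.val ≠ w.val := by
    intro w k hw
    have := hout k
    rw [← hw] at this
    refine ⟨?_, fun hh => this.2 (by rw [Fin.ext hh])⟩
    rw [← Bool.not_eq_true, hA]
    exact this.1
  rw [isoB, allN_iff] at h
  have h1 := h y y.2
  rw [← hx, ← hy] at h01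
  rw [← hz, ← hy] at h12
  rw [← hA] at h01 h12
  obtain ⟨hx1, hx2⟩ := nA x 0 hx
  obtain ⟨hy1, hy2⟩ := nA y 1 hy
  obtain ⟨hz1, hz2⟩ := nA z 2 hz
  simp only [hy1, Bool.false_or, Bool.or_eq_true, Nat.beq_eq, hy2, false_or, Nat.ble_eq,
    countN_eq, Finset.card_le_one, Finset.mem_filter, Finset.mem_range] at h1
  have hxz : x.val = z.val := h1 x ⟨x.2, by simp [h01, hx1, beqF hx2]⟩ z
    ⟨z.2, by simp [h12, hz1, beqF hz2]⟩
  have : f 0 = f 2 := Subtype.ext (by rw [← hx, ← hz, Fin.ext hxz])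
  exact absurd (hf this) (by decide)

lemma cutB_sound (hA : ∀ i j : Fin n, A i j = true ↔ G.Adj (e i) (e j)) (hc : G.Connected)
    {S : ℕ → Bool} (i j : Fin n) (hi : S i = true) (hj : S j = false) :
    cutB n A S = false := by
  by_contra h
  rw [Bool.not_eq_false, cutB, allN_iff] at h
  have step : ∀ a b : Fin n, S a = true → G.Adj (e a) (e b) → S b = true := by
    intro a b ha hab
    have h1 := h a a.2
    simp only [ha, Bool.not_true, Bool.false_or, allN_iff] at h1
    have h2 := h1 b b.2
    rw [← hA] at hab
    simpa [hab] using h2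
  have key : ∀ u w, G.Walk u w → S (e.symm u) = true → S (e.symm w) = true := by
    intro u w p
    induction p with
    | nil => exact id
    | cons hadj _ ih => exact fun hu => ih (step _ _ hu (by simpa using hadj))
  obtain ⟨p⟩ := hc.preconnected (e i) (e j)
  have := key _ _ p (by simpa using hi)
  simp [hj] at this

lemma bigB_sound [Fintype V] [DecidableRel G.Adj]
    (hA : ∀ i j : Fin n, A i j = true ↔ G.Adj (e i) (e j))
    {d : ℕ} (hd : ∀ v, G.degree v ≤ d) : bigB n A d = false := by
  by_contra h
  rw [Bool.not_eq_false, bigB, anyN_iff] at h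
  obtain ⟨i, hin, hi⟩ := h
  rw [Nat.ble_eq, countN_eq] at hi
  have hle : ((Finset.range n).filter (fun k => A i k = true)).card ≤
      G.degree (e ⟨i, hin⟩) := by
    rw [← SimpleGraph.card_neighborFinset_eq_degree]
    refine Finset.card_le_card_of_injOn (fun k => if h : k < n then e ⟨k, h⟩ else e ⟨i, hin⟩) ?_ ?_
    · intro x hx
      simp only [Finset.coe_filter, Finset.mem_range, Set.mem_ofPred_eq] at hx
      have := (hA ⟨i, hin⟩ ⟨x, hx.1⟩).mp hx.2
      simpa [hx.1] using this
    · intro x hx y hy hxy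
      simp only [Finset.coe_filter, Finset.mem_range, Set.mem_ofPred_eq] at hx hy
      simpa [hx.1, hy.1] using hxy
  have := hd (e ⟨i, hin⟩)
  omega

lemma embB_sound {m : ℕ} {H : ℕ → ℕ → Bool} {s : ℕ → ℕ}
    (hA : ∀ i j : Fin n, A i j = true ↔ G.Adj (e i) (e j)) (h : embB m n A H s = true) :
    ∃ f : Fin m → V, Function.Injective f ∧
      ∀ i j : Fin m, G.Adj (f i) (f j) ↔ H i j = true := by
  simp only [embB, allN_iff, Bool.and_eq_true, Nat.ble_eq,
    Bool.or_eq_true, Nat.beq_eq, Bool.not_eq_true'] at h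
  refine ⟨fun i => e ⟨s i, (h i i.2).1⟩, ?_, ?_⟩
  · intro i j hij
    have h1 : s i = s j := by simpa using hij
    rcases ((h i i.2).2 j j.2).2 with h' | h'
    · exact Fin.ext h'
    · rw [h1] at h'
      simp at h'
  · intro i j
    rw [← hA]
    have := ((h i i.2).2 j j.2).1
    cases hH : H i j <;> simp_all

lemma embB_iso {H : ℕ → ℕ → Bool} {K : SimpleGraph (Fin n)}
    (hK : ∀ i j : Fin n, H i j = true ↔ K.Adj i j) {s : ℕ → ℕ}
    (hA : ∀ i j : Fin n, A i j = true ↔ G.Adj (e i) (e j)) (h : embB n n A H s = true) :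
    Nonempty (G ≃g K) := by
  obtain ⟨f, h1, h2⟩ := embB_sound hA h
  haveI : Finite V := Finite.of_equiv _ e
  haveI := Fintype.ofFinite V
  have hb : Function.Bijective f :=
    (Fintype.bijective_iff_injective_and_card f).mpr ⟨h1, Fintype.card_congr e⟩
  refine ⟨SimpleGraph.Iso.symm ⟨Equiv.ofBijective f hb, ?_⟩⟩
  intro a b
  rw [← hK]
  exact h2 a b

end Sound

/-- Symmetries of the labelling of a graph around a vertex of degree three, in octal. -/
def syms : List ℕ := [1754760, 1238664, 1754312, 1238216, 1754704, 1238608, 1753808, 1237712, 1754200, 1238104, 1753752, 1237656]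

/-- Some symmetric image of one of the listed maps is an embedding. -/
def anyEmb (m : ℕ) (A H : ℕ → ℕ → Bool) (bs : List ℕ) : Bool :=
  bs.any fun b => syms.any fun s => embB m 7 A H (fun i => dig s (dig b i))

lemma anyEmb_spec {m : ℕ} {A H : ℕ → ℕ → Bool}
    {bs : List ℕ} (h : anyEmb m A H bs = true) :
    ∃ s, embB m 7 A H s = true := by
  simp only [anyEmb, List.any_eq_true] at h
  obtain ⟨b, -, s, -, h⟩ := h
  exact ⟨_, h⟩

/-- The check for seven vertices with a vertex of degree three. -/
def chk3 (A : ℕ → ℕ → Bool) : Bool :=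
  bigB 7 A 3 || (anyN 7 (isoB 7 A) || (cutB 7 A (fun i => Nat.ble i 3) ||
  (anyEmb 6 A (adjM 594895078050) [92936] ||
  (anyEmb 7 A (adjM 4994015593186)
    [875784, 1717261, 879368] ||
  (anyEmb 7 A (adjM 13790108623586)
    [879368, 875784, 878920, 1005697] ||
  (anyEmb 7 A (adjM 40178521899746)
    [879368, 1717261] ||
  (anyEmb 7 A (adjM 48974614930146)
    [879368, 1005697, 875784] ||
  (anyEmb 7 A (adjM 156965024473794)
    [977025, 1520652] ||
  anyEmb 7 A (adjM 156967205511874)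
    [1005697, 1679468, 977025, 1520652, 1679461]))))))))

/-- The check for seven vertices of degree at most two. -/
def chk2 (A : ℕ → ℕ → Bool) : Bool :=
  bigB 7 A 2 || (anyN 7 (isoB 7 A) || (cutB 7 A (fun i => Nat.ble i 2) ||
  (cutB 7 A (fun i => Nat.ble 6 i) || (cutB 7 A (fun i => Nat.ble 3 i && Nat.ble i 5) ||
  [743624, 735560, 706440, 641928].any fun b => embB 7 7 A (adjM 147895093461698) (dig b)))))

/-- The check for six vertices of degree at most two. -/
def chk6 (A : ℕ → ℕ → Bool) : Bool :=
  bigB 6 A 2 || (anyN 6 (isoB 6 A) || (cutB 6 A (fun i => Nat.ble i 2) ||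
  [88264, 80200].any fun b => embB 6 6 A (adjM 594895078050) (dig b)))

/-- The number with low bits `0, 1`, followed by the bits of `128 * a + b`. -/
def code (a b : ℕ) : ℕ := Nat.add (Nat.mul 4 (Nat.add (Nat.mul 128 a) b)) 2

lemma chk6_all : (allN 2 fun a => allN 128 fun b => chk6 (mat 111815941902267332964976666183663528354213003536 (code a b))) = true := by
  decide +kernel

lemma chk2_all : (allN 64 fun a => allN 128 fun b => chk2 (mat 2484043713325530388239361491960758901986862191325850108176 (code a b))) = true := by
  decide +kernel

lemma chk3_all : (allN 64 fun a => allN 128 fun b => chk3 (mat 537474944026370053412484812305815746402728308983893856528 (code a b))) = true := by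
  decide +kernel

lemma bit_eq (m k : ℕ) : bit m k = m.testBit k := by
  have h : (m >>> k) &&& 1 = 0 ∨ (m >>> k) &&& 1 = 1 := by
    rw [Nat.and_one_is_mod]; omega
  have h1 : bit m k = Nat.beq ((m >>> k) &&& 1) 1 := rfl
  rw [h1, Nat.testBit, Nat.and_comm 1]
  rcases h with h | h <;> rw [h] <;> rfl

lemma exists_code (c : ℕ) (F : Fin (c + 7 + 2) → Bool) (h0 : F 0 = false) (h1 : F 1 = true) :
    ∃ a < 2 ^ c, ∃ b < 128, ∀ t : Fin (c + 7 + 2), bit (code a b) t = F t := by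
  obtain ⟨x, hx⟩ : ∃ x, x = Nat.ofBits (fun t : Fin (c + 7) => F t.succ.succ) := ⟨_, rfl⟩
  have hlt : x < 2 ^ (c + 7) := hx ▸ Nat.ofBits_lt_two_pow _
  refine ⟨x / 128, ?_, x % 128, Nat.mod_lt _ (by norm_num), ?_⟩
  · rw [pow_add] at hlt
    exact Nat.div_lt_of_lt_mul (by rw [mul_comm]; exact hlt)
  have hcode : code (x / 128) (x % 128) = 4 * x + 2 := by
    have : code (x / 128) (x % 128) = 4 * (128 * (x / 128) + x % 128) + 2 := rfl
    rw [this, Nat.div_add_mod]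
  intro t
  rw [hcode, bit_eq]
  refine Fin.cases ?_ (fun t => Fin.cases ?_ (fun t => ?_) t) t
  · rw [h0, Fin.val_zero, Nat.testBit_zero]
    simp only [decide_eq_false_iff_not]
    omega
  · have h1' : F (Fin.succ 0) = true := h1
    rw [h1', Fin.val_succ, Nat.testBit_succ, Fin.val_zero, Nat.testBit_zero]
    simp only [decide_eq_true_eq]
    omega
  · rw [Fin.val_succ, Fin.val_succ, Nat.testBit_succ, Nat.testBit_succ,
      show (4 * x + 2) / 2 / 2 = x by omega, hx, Nat.testBit_ofBits_lt _ _ t.2]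

section Cases

variable {V : Type*} [Fintype V] {G : SimpleGraph V} [DecidableRel G.Adj]

lemma case3 (e : Fin 7 ≃ V) (hconn : G.Connected) (hdeg : ∀ v, G.degree v ≤ 3)
    (hno : ∀ v, ¬ IsP3Isolating G (({v} : Finset V) : Set V))
    (hc6 : ¬ hasInducedC6 G)
    (h71 : ¬ Nonempty (G ≃g G71graph)) (h72 : ¬ Nonempty (G ≃g G72graph))
    (h73 : ¬ Nonempty (G ≃g G73graph)) (h74 : ¬ Nonempty (G ≃g G74graph))
    (h75 : ¬ Nonempty (G ≃g G75graph)) (h76 : ¬ Nonempty (G ≃g G76graph))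
    (a01 : G.Adj (e 0) (e 1)) (a02 : G.Adj (e 0) (e 2)) (a03 : G.Adj (e 0) (e 3))
    (a45 : G.Adj (e 4) (e 5)) (a56 : G.Adj (e 5) (e 6))
    (n04 : ¬ G.Adj (e 0) (e 4)) (n05 : ¬ G.Adj (e 0) (e 5)) (n06 : ¬ G.Adj (e 0) (e 6)) :
    False := by
  obtain ⟨F, hF⟩ : ∃ F : Fin 15 → Bool, F = ![false, true,
      decide (G.Adj (e 1) (e 2)),
      decide (G.Adj (e 1) (e 3)),
      decide (G.Adj (e 2) (e 3)),
      decide (G.Adj (e 4) (e 6)),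
      decide (G.Adj (e 1) (e 4)),
      decide (G.Adj (e 1) (e 5)),
      decide (G.Adj (e 1) (e 6)),
      decide (G.Adj (e 2) (e 4)),
      decide (G.Adj (e 2) (e 5)),
      decide (G.Adj (e 2) (e 6)),
      decide (G.Adj (e 3) (e 4)),
      decide (G.Adj (e 3) (e 5)),
      decide (G.Adj (e 3) (e 6))] := ⟨_, rfl⟩
  obtain ⟨J, hJ⟩ : ∃ J : Fin 7 → Fin 7 → Fin 15, J = ![![0, 1, 1, 1, 0, 0, 0],
      ![1, 0, 2, 3, 6, 7, 8],
      ![1, 2, 0, 4, 9, 10, 11],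
      ![1, 3, 4, 0, 12, 13, 14],
      ![0, 6, 9, 12, 0, 1, 5],
      ![0, 7, 10, 13, 1, 0, 1],
      ![0, 8, 11, 14, 5, 1, 0]] := ⟨_, rfl⟩
  obtain ⟨a, ha, b, hb, hab⟩ := exists_code 6 F (by rw [hF]; rfl) (by rw [hF]; rfl)
  have hT : ∀ i j : Fin 7, idx 537474944026370053412484812305815746402728308983893856528 i j = J i j := by
    rw [hJ]; decide
  have hA : ∀ i j : Fin 7, mat 537474944026370053412484812305815746402728308983893856528 (code a b) i j = true ↔ G.Adj (e i) (e j) := by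
    intro i j
    rw [mat, hT, hab, hF, hJ]
    fin_cases i <;> fin_cases j <;>
      simp [a01, a02, a03, a45, a56, a01.symm, a02.symm, a03.symm, a45.symm, a56.symm,
        n04, n05, n06, G.adj_comm _ (e 0)] <;> exact G.adj_comm _ _
  have hk := (allN_iff _ _).mp ((allN_iff _ _).mp chk3_all a (by simpa using ha)) b hb
  simp only [chk3, Bool.or_eq_true] at hk
  rcases hk with h | h | h | h | h | h | h | h | h | h
  · rw [bigB_sound hA hdeg] at h
    exact absurd h (by simp)
  · obtain ⟨v, hv, h⟩ := (anyN_iff _ _).mp h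
    exact hno _ (isoB_sound (v := ⟨v, hv⟩) hA h)
  · rw [cutB_sound hA hconn 0 4 rfl rfl] at h
    exact absurd h (by simp)
  · obtain ⟨s, hs⟩ := anyEmb_spec h
    obtain ⟨f, hf, hf'⟩ := embB_sound hA hs
    exact hc6 ⟨f, hf, fun i j => (hf' i j).trans (c6_iff i j)⟩
  · obtain ⟨s, hs⟩ := anyEmb_spec h
    exact h71 (embB_iso g1_iff hA hs)
  · obtain ⟨s, hs⟩ := anyEmb_spec h
    exact h72 (embB_iso g2_iff hA hs)
  · obtain ⟨s, hs⟩ := anyEmb_spec h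
    exact h73 (embB_iso g3_iff hA hs)
  · obtain ⟨s, hs⟩ := anyEmb_spec h
    exact h74 (embB_iso g4_iff hA hs)
  · obtain ⟨s, hs⟩ := anyEmb_spec h
    exact h75 (embB_iso g5_iff hA hs)
  · obtain ⟨s, hs⟩ := anyEmb_spec h
    exact h76 (embB_iso g6_iff hA hs)

lemma case2 (e : Fin 7 ≃ V) (hconn : G.Connected) (hdeg : ∀ v, G.degree v ≤ 2)
    (hno : ∀ v, ¬ IsP3Isolating G (({v} : Finset V) : Set V))
    (hc7 : ¬ Nonempty (G ≃g SimpleGraph.cycleGraph 7))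
    (a01 : G.Adj (e 0) (e 1)) (a02 : G.Adj (e 0) (e 2))
    (a34 : G.Adj (e 3) (e 4)) (a45 : G.Adj (e 4) (e 5))
    (n03 : ¬ G.Adj (e 0) (e 3)) (n04 : ¬ G.Adj (e 0) (e 4)) (n05 : ¬ G.Adj (e 0) (e 5))
    (n06 : ¬ G.Adj (e 0) (e 6)) : False := by
  obtain ⟨F, hF⟩ : ∃ F : Fin 15 → Bool, F = ![false, true,
      decide (G.Adj (e 1) (e 2)),
      decide (G.Adj (e 3) (e 5)),
      decide (G.Adj (e 3) (e 6)),
      decide (G.Adj (e 4) (e 6)),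
      decide (G.Adj (e 5) (e 6)),
      decide (G.Adj (e 1) (e 3)),
      decide (G.Adj (e 1) (e 4)),
      decide (G.Adj (e 1) (e 5)),
      decide (G.Adj (e 1) (e 6)),
      decide (G.Adj (e 2) (e 3)),
      decide (G.Adj (e 2) (e 4)),
      decide (G.Adj (e 2) (e 5)),
      decide (G.Adj (e 2) (e 6))] := ⟨_, rfl⟩
  obtain ⟨J, hJ⟩ : ∃ J : Fin 7 → Fin 7 → Fin 15, J = ![![0, 1, 1, 0, 0, 0, 0],
      ![1, 0, 2, 7, 8, 9, 10],
      ![1, 2, 0, 11, 12, 13, 14],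
      ![0, 7, 11, 0, 1, 3, 4],
      ![0, 8, 12, 1, 0, 1, 5],
      ![0, 9, 13, 3, 1, 0, 6],
      ![0, 10, 14, 4, 5, 6, 0]] := ⟨_, rfl⟩
  obtain ⟨a, ha, b, hb, hab⟩ := exists_code 6 F (by rw [hF]; rfl) (by rw [hF]; rfl)
  have hT : ∀ i j : Fin 7, idx 2484043713325530388239361491960758901986862191325850108176 i j = J i j := by
    rw [hJ]; decide
  have hA : ∀ i j : Fin 7, mat 2484043713325530388239361491960758901986862191325850108176 (code a b) i j = true ↔ G.Adj (e i) (e j) := by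
    intro i j
    rw [mat, hT, hab, hF, hJ]
    fin_cases i <;> fin_cases j <;>
      simp [a01, a02, a34, a45, a01.symm, a02.symm, a34.symm, a45.symm,
        n03, n04, n05, n06, G.adj_comm _ (e 0)] <;> exact G.adj_comm _ _
  have hk := (allN_iff _ _).mp ((allN_iff _ _).mp chk2_all a (by simpa using ha)) b hb
  simp only [chk2, Bool.or_eq_true] at hk
  rcases hk with h | h | h | h | h | h
  · rw [bigB_sound hA hdeg] at h
    exact absurd h (by simp)
  · obtain ⟨v, hv, h⟩ := (anyN_iff _ _).mp h
    exact hno _ (isoB_sound (v := ⟨v, hv⟩) hA h)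
  · rw [cutB_sound hA hconn 0 4 rfl rfl] at h
    exact absurd h (by simp)
  · rw [cutB_sound hA hconn 6 0 rfl rfl] at h
    exact absurd h (by simp)
  · rw [cutB_sound hA hconn 3 0 rfl rfl] at h
    exact absurd h (by simp)
  · rw [List.any_eq_true] at h
    obtain ⟨s, -, hs⟩ := h
    exact hc7 (embB_iso c7_iff hA hs)

lemma case6 (e : Fin 6 ≃ V) (hconn : G.Connected) (hdeg : ∀ v, G.degree v ≤ 2)
    (hno : ∀ v, ¬ IsP3Isolating G (({v} : Finset V) : Set V))
    (hc6 : ¬ hasInducedC6 G)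
    (a01 : G.Adj (e 0) (e 1)) (a02 : G.Adj (e 0) (e 2))
    (a34 : G.Adj (e 3) (e 4)) (a45 : G.Adj (e 4) (e 5))
    (n03 : ¬ G.Adj (e 0) (e 3)) (n04 : ¬ G.Adj (e 0) (e 4)) (n05 : ¬ G.Adj (e 0) (e 5)) :
    False := by
  obtain ⟨F, hF⟩ : ∃ F : Fin 10 → Bool, F = ![false, true,
      decide (G.Adj (e 1) (e 2)),
      decide (G.Adj (e 3) (e 5)),
      decide (G.Adj (e 1) (e 3)),
      decide (G.Adj (e 1) (e 4)),
      decide (G.Adj (e 1) (e 5)),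
      decide (G.Adj (e 2) (e 3)),
      decide (G.Adj (e 2) (e 4)),
      decide (G.Adj (e 2) (e 5))] := ⟨_, rfl⟩
  obtain ⟨J, hJ⟩ : ∃ J : Fin 6 → Fin 6 → Fin 10, J = ![![0, 1, 1, 0, 0, 0],
      ![1, 0, 2, 4, 5, 6],
      ![1, 2, 0, 7, 8, 9],
      ![0, 4, 7, 0, 1, 3],
      ![0, 5, 8, 1, 0, 1],
      ![0, 6, 9, 3, 1, 0]] := ⟨_, rfl⟩
  obtain ⟨a, ha, b, hb, hab⟩ := exists_code 1 F (by rw [hF]; rfl) (by rw [hF]; rfl)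
  have hT : ∀ i j : Fin 6, idx 111815941902267332964976666183663528354213003536 i j = J i j := by
    rw [hJ]; decide
  have hA : ∀ i j : Fin 6, mat 111815941902267332964976666183663528354213003536 (code a b) i j = true ↔ G.Adj (e i) (e j) := by
    intro i j
    rw [mat, hT, hab, hF, hJ]
    fin_cases i <;> fin_cases j <;>
      simp [a01, a02, a34, a45, a01.symm, a02.symm, a34.symm, a45.symm,
        n03, n04, n05, G.adj_comm _ (e 0)] <;> exact G.adj_comm _ _
  have hk := (allN_iff _ _).mp ((allN_iff _ _).mp chk6_all a (by simpa using ha)) b hb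
  simp only [chk6, Bool.or_eq_true] at hk
  rcases hk with h | h | h | h
  · rw [bigB_sound hA hdeg] at h
    exact absurd h (by simp)
  · obtain ⟨v, hv, h⟩ := (anyN_iff _ _).mp h
    exact hno _ (isoB_sound (v := ⟨v, hv⟩) hA h)
  · rw [cutB_sound hA hconn 0 4 rfl rfl] at h
    exact absurd h (by simp)
  · rw [List.any_eq_true] at h
    obtain ⟨s, -, hs⟩ := h
    obtain ⟨f, hf, hf'⟩ := embB_sound hA hs
    exact hc6 ⟨f, hf, fun i j => (hf' i j).trans (c6_iff i j)⟩

end Cases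

lemma not_iso_spec {V : Type*} {G : SimpleGraph V} {v : V}
    (h : ¬ IsP3Isolating G (({v} : Finset V) : Set V)) :
    ∃ x y z, x ≠ y ∧ x ≠ z ∧ y ≠ z ∧ G.Adj x y ∧ G.Adj y z ∧ v ≠ x ∧ v ≠ y ∧ v ≠ z ∧
      ¬ G.Adj v x ∧ ¬ G.Adj v y ∧ ¬ G.Adj v z := by
  rw [IsP3Isolating, not_not] at h
  obtain ⟨f, hf, hadj⟩ := h
  have hout : ∀ k, ¬ G.Adj v (f k) ∧ v ≠ (f k : V) := by
    intro k
    have := (f k).2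
    simp only [closedNbhd, Set.mem_compl_iff, Set.mem_ofPred_eq, Finset.coe_singleton,
      Set.mem_singleton_iff, exists_eq_left, not_or] at this
    exact ⟨this.2, fun hh => this.1 hh.symm⟩
  have hne : ∀ a b, a ≠ b → (f a : V) ≠ f b := fun a b hab h => hab (hf (Subtype.ext h))
  exact ⟨f 0, f 1, f 2, hne _ _ (by decide), hne _ _ (by decide), hne _ _ (by decide),
    hadj 0 1 (by simp [SimpleGraph.pathGraph_adj]), hadj 1 2 (by simp [SimpleGraph.pathGraph_adj]),
    (hout 0).2, (hout 1).2, (hout 2).2, (hout 0).1, (hout 1).1, (hout 2).1⟩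

lemma not_contains_iota {V : Type*} {G : SimpleGraph V} (h : ¬ containsP3 G) :
    iotaP3 G = 0 := by
  apply Nat.le_zero.mp
  apply Nat.sInf_le
  refine ⟨∅, rfl, ?_⟩
  rintro ⟨f, hf, hadj⟩
  exact h ⟨fun i => f i, fun a b hab => hf (Subtype.ext hab), fun a b hab => hadj a b hab⟩

lemma card3 {V : Type*} [Fintype V] {G : SimpleGraph V} (hP : containsP3 G)
    (hcard : Fintype.card V = 3)
    (h3 : ¬ Nonempty (G ≃g SimpleGraph.pathGraph 3))
    (hc3 : ¬ Nonempty (G ≃g SimpleGraph.cycleGraph 3)) : False := by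
  obtain ⟨f, hf, hadj⟩ := hP
  have hb : Function.Bijective f :=
    (Fintype.bijective_iff_injective_and_card f).mpr ⟨hf, by simp [hcard]⟩
  have h01 : G.Adj (f 0) (f 1) := hadj 0 1 (by simp [SimpleGraph.pathGraph_adj])
  have h12 : G.Adj (f 1) (f 2) := hadj 1 2 (by simp [SimpleGraph.pathGraph_adj])
  by_cases h02 : G.Adj (f 0) (f 2)
  · refine hc3 ⟨SimpleGraph.Iso.symm ⟨Equiv.ofBijective f hb, ?_⟩⟩
    intro a b
    rw [Equiv.ofBijective_apply, Equiv.ofBijective_apply]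
    fin_cases a <;> fin_cases b <;>
      simp [h01, h12, h02, h01.symm, h12.symm, h02.symm, SimpleGraph.cycleGraph_adj] <;> decide
  · have h20 : ¬ G.Adj (f 2) (f 0) := fun h => h02 h.symm
    refine h3 ⟨SimpleGraph.Iso.symm ⟨Equiv.ofBijective f hb, ?_⟩⟩
    intro a b
    rw [Equiv.ofBijective_apply, Equiv.ofBijective_apply]
    fin_cases a <;> fin_cases b <;>
      simp [h01, h12, h02, h01.symm, h12.symm, h20, SimpleGraph.pathGraph_adj]

end Stmt16Aux

/-- If `G` is a connected subcubic graph on `n ≤ 7` vertices with no induced `6`-cycle that is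
not a copy of `P3`, `C3`, `C7` or any of `G₇,₁, …, G₇,₆`, then `ι(G, P3) ≤ n/4`. -/
theorem stmt16 {V : Type*} [Fintype V] (G : SimpleGraph V) [DecidableRel G.Adj]
    (hn : Fintype.card V ≤ 7) (hconn : G.Connected) (hdeg : ∀ v, G.degree v ≤ 3)
    (hc6 : ¬ hasInducedC6 G)
    (h3 : ¬ Nonempty (G ≃g SimpleGraph.pathGraph 3))
    (hc3 : ¬ Nonempty (G ≃g SimpleGraph.cycleGraph 3))
    (hc7 : ¬ Nonempty (G ≃g SimpleGraph.cycleGraph 7))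
    (h71 : ¬ Nonempty (G ≃g G71graph)) (h72 : ¬ Nonempty (G ≃g G72graph))
    (h73 : ¬ Nonempty (G ≃g G73graph)) (h74 : ¬ Nonempty (G ≃g G74graph))
    (h75 : ¬ Nonempty (G ≃g G75graph)) (h76 : ¬ Nonempty (G ≃g G76graph)) :
    (iotaP3 G : ℝ) ≤ (Fintype.card V : ℝ) / 4 := by
  classical
  by_cases hP : containsP3 G
  swap
  · rw [Stmt16Aux.not_contains_iota hP]
    simp only [Nat.cast_zero]
    positivity
  have hge3 : 3 ≤ Fintype.card V := by
    obtain ⟨f, hf, -⟩ := hP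
    simpa using Fintype.card_le_of_injective f hf
  have hne3 : Fintype.card V ≠ 3 := fun h => Stmt16Aux.card3 hP h h3 hc3
  have hge4 : (4 : ℝ) ≤ Fintype.card V := by
    have : 4 ≤ Fintype.card V := by omega
    exact_mod_cast this
  suffices h : iotaP3 G ≤ 1 by
    have h' : (iotaP3 G : ℝ) ≤ 1 := by exact_mod_cast h
    linarith
  by_contra hlt
  have hno : ∀ v, ¬ IsP3Isolating G (({v} : Finset V) : Set V) := by
    intro v hv
    exact hlt (Nat.sInf_le ⟨{v}, Finset.card_singleton v, hv⟩)
  by_cases hd3 : ∃ v, G.degree v = 3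
  · obtain ⟨v, hv⟩ := hd3
    rw [← SimpleGraph.card_neighborFinset_eq_degree, Finset.card_eq_three] at hv
    obtain ⟨a, b, c, hab, hac, hbc, hN⟩ := hv
    have hm : ∀ w, G.Adj v w ↔ w = a ∨ w = b ∨ w = c := by
      intro w
      rw [← SimpleGraph.mem_neighborFinset, hN]
      simp
    have ha : G.Adj v a := (hm a).mpr (by simp)
    have hb : G.Adj v b := (hm b).mpr (by simp)
    have hc : G.Adj v c := (hm c).mpr (by simp)
    obtain ⟨x, y, z, hxy, hxz, hyz, axy, ayz, vx, vy, vz, nx, ny, nz⟩ :=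
      Stmt16Aux.not_iso_spec (hno v)
    have hva := ha.ne
    have hvb := hb.ne
    have hvc := hc.ne
    have hinj : Function.Injective ![v, a, b, c, x, y, z] := by
      rw [← List.nodup_ofFn]
      simp only [List.ofFn_succ, List.ofFn_zero, Matrix.cons_val_zero, Matrix.cons_val_succ]
      simp only [List.nodup_cons, List.mem_cons, List.not_mem_nil, List.nodup_nil]
      grind
    have hcard : Fintype.card V = 7 := by
      have := Fintype.card_le_of_injective _ hinj
      simp only [Fintype.card_fin] at this
      omega
    have hbij := (Fintype.bijective_iff_injective_and_card _).mpr
      ⟨hinj, by simp [hcard]⟩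
    exact Stmt16Aux.case3 (Equiv.ofBijective _ hbij) hconn hdeg hno hc6 h71 h72 h73 h74 h75 h76
      ha hb hc axy ayz nx ny nz
  · have hd2 : ∀ v, G.degree v ≤ 2 := by
      intro v
      have h1 := hdeg v
      have h2 : G.degree v ≠ 3 := fun h => hd3 ⟨v, h⟩
      omega
    obtain ⟨f, hf, hadj⟩ := hP
    obtain ⟨v, a, b, hab, ha, hb⟩ : ∃ v a b, a ≠ b ∧ G.Adj v a ∧ G.Adj v b :=
      ⟨f 1, f 0, f 2, fun h => absurd (hf h) (by decide),
        hadj 1 0 (by simp [SimpleGraph.pathGraph_adj]),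
        hadj 1 2 (by simp [SimpleGraph.pathGraph_adj])⟩
    obtain ⟨x, y, z, hxy, hxz, hyz, axy, ayz, vx, vy, vz, nx, ny, nz⟩ :=
      Stmt16Aux.not_iso_spec (hno v)
    have hva := ha.ne
    have hvb := hb.ne
    have hinj : Function.Injective ![v, a, b, x, y, z] := by
      rw [← List.nodup_ofFn]
      simp only [List.ofFn_succ, List.ofFn_zero, Matrix.cons_val_zero, Matrix.cons_val_succ]
      simp only [List.nodup_cons, List.mem_cons, List.not_mem_nil, List.nodup_nil]
      grind
    have hcard : Fintype.card V = 6 ∨ Fintype.card V = 7 := by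
      have := Fintype.card_le_of_injective _ hinj
      simp only [Fintype.card_fin] at this
      omega
    rcases hcard with hcard | hcard
    · have hbij := (Fintype.bijective_iff_injective_and_card _).mpr
        ⟨hinj, by simp [hcard]⟩
      exact Stmt16Aux.case6 (Equiv.ofBijective _ hbij) hconn hd2 hno hc6
        ha hb axy ayz nx ny nz
    · obtain ⟨w, hw⟩ : ∃ w, w ∉ ({v, a, b, x, y, z} : Finset V) := by
        by_contra hall
        push Not at hall
        have h1 : Fintype.card V ≤ ({v, a, b, x, y, z} : Finset V).card :=
          Finset.card_le_card (fun w _ => hall w)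
        have h2 := Finset.card_le_six (a := v) (b := a) (c := b) (d := x) (e := y) (f := z)
        omega
      simp only [Finset.mem_insert, Finset.mem_singleton, not_or] at hw
      obtain ⟨wv, wa, wb, wx, wy, wz⟩ := hw
      have nw : ¬ G.Adj v w := by
        intro hvw
        have h1 : ({a, b, w} : Finset V) ⊆ G.neighborFinset v := by
          intro u hu
          simp only [Finset.mem_insert, Finset.mem_singleton] at hu
          rw [SimpleGraph.mem_neighborFinset]
          rcases hu with rfl | rfl | rfl <;> assumption
        have h2 := Finset.card_le_card h1
        rw [Finset.card_eq_three.mpr ⟨a, b, w, hab, Ne.symm wa, Ne.symm wb, rfl⟩,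
          SimpleGraph.card_neighborFinset_eq_degree] at h2
        have := hd2 v
        omega
      have hinj7 : Function.Injective ![v, a, b, x, y, z, w] := by
        rw [← List.nodup_ofFn]
        simp only [List.ofFn_succ, List.ofFn_zero, Matrix.cons_val_zero, Matrix.cons_val_succ]
        simp only [List.nodup_cons, List.mem_cons, List.not_mem_nil, List.nodup_nil]
        grind
      have hbij := (Fintype.bijective_iff_injective_and_card _).mpr
        ⟨hinj7, by simp [hcard]⟩
      exact Stmt16Aux.case2 (Equiv.ofBijective _ hbij) hconn hd2 hno hc7
        ha hb axy ayz nx ny nz nw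
end

section
/- If G is a connected subcubic graph on n vertices with 8 ≤ n ≤ 11, G has no induced 6-cycle, and G is not isomorphic to C11 or G11, then ι(G, P3) ≤ 2. -/
open SimpleGraph

/-! ### The certificate checker

A state of the search is a pair `(P, A)`: `P` is the bit mask of the processed vertices
(those whose neighbourhood is completely known) and `A` packs the known adjacency matrix,
sixteen bits per row, starting at bit `64`.  All functions are written so that the kernel evaluates them quickly. -/

namespace P3Search

/-- Boolean selection. -/
noncomputable def sel {α : Type} (b : Bool) (x y : α) : α :=
  Bool.rec (motive := fun _ => α) y x b

/-- Force the evaluation of a natural number before passing it on. -/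
noncomputable def frc {α : Type} (x : Nat) (f : Nat → α) : α :=
  Nat.rec (motive := fun _ => α) (f 0) (fun k _ => f (Nat.succ k)) x

/-- Bit `i` of the mask `m`. -/
def bt (m i : Nat) : Bool := Nat.beq (Nat.mod (Nat.shiftRight m i) 2) 1

/-- The mask with the single bit `i`. -/
def one (i : Nat) : Nat := Nat.shiftLeft 1 i

/-- Row `i` of a packed adjacency matrix. -/
def row (A i : Nat) : Nat := Nat.mod (Nat.shiftRight A (Nat.add (Nat.mul 16 i) 64)) 65536

/-- Replace the (irrelevant) lowest `64` bits of `A` by a check sum.  This gives different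
matrices different hash values, which makes the evaluation in the kernel much faster. -/
def salt (A : Nat) : Nat :=
  Nat.lor (Nat.shiftLeft (Nat.shiftRight A 64) 64) (Nat.mod A 2305843009213693951)

/-- The mask `z` has at most one bit. -/
def le1 (z : Nat) : Bool := Nat.beq (Nat.land z (Nat.sub z 1)) 0

/-- Bounded universal quantifier. -/
noncomputable def loop (n : Nat) (p : Nat → Bool) : Bool :=
  Nat.rec (motive := fun _ => Bool) true (fun v ih => sel (p v) ih false) n

/-- Number of bits of `x` below `n`. -/
noncomputable def pc (n x : Nat) : Nat :=
  Nat.rec (motive := fun _ => Nat) 0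
    (fun i ih => Nat.add ih (Nat.mod (Nat.shiftRight x i) 2)) n

/-- The mask of all the bits below `n` satisfying `p`. -/
noncomputable def mask (n : Nat) (p : Nat → Bool) : Nat :=
  Nat.rec (motive := fun _ => Nat) 0 (fun j ih => sel (p j) (Nat.lor (one j) ih) ih) n

/-- Complement of `m` in the mask `all`. -/
def compl (all m : Nat) : Nat := Nat.xor all (Nat.land all m)

/-- Add the edge `vj`. -/
noncomputable def addE (A v j : Nat) : Nat :=
  frc (Nat.lor A (Nat.lor (one (Nat.add (Nat.add (Nat.mul 16 v) 64) j))
    (one (Nat.add (Nat.add (Nat.mul 16 j) 64) v)))) salt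

/-- Whatever the unknown edges are, `{x, y}` is isolating. -/
noncomputable def dchk (n all P A x y : Nat) : Bool :=
  frc (Nat.land all (Nat.lor (Nat.lor (row A x) (row A y)) (Nat.lor (one x) (one y)))) fun cov =>
  frc (compl all cov) fun rem =>
  frc (compl all P) fun un =>
  loop n fun v => sel (bt rem v)
    (frc (row A v) fun r =>
      sel (frc (Nat.land (Nat.lor r (sel (bt P v) 0 (compl un (one v)))) rem) le1) true
        (sel (frc (Nat.land r cov) le1) false true))
    true

/-- Vertex `j` may be added to the new neighbours `S`: every larger twin is in `S`. -/
noncomputable def canon (n U A S j : Nat) : Bool :=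
  frc (row A j) fun r => loop n fun i =>
    sel (Nat.ble i j) true (sel (bt U i) (sel (bt S i) true (sel (Nat.beq (row A i) r) false true)) true)

/-- The certificate reader type. -/
abbrev Rd := List Nat → Option (List Nat)

/-- Sequencing. -/
noncomputable def bnd (x : Option (List Nat)) (f : Rd) : Option (List Nat) :=
  Option.rec (motive := fun _ => Option (List Nat)) none f x

/-- Read one digit. -/
noncomputable def unc (ds : List Nat) (f : Nat → Rd) : Option (List Nat) :=
  List.rec (motive := fun _ => Option (List Nat)) none (fun d ds _ => frc d fun d => f d ds) ds

/-- Read `k` digits into one number. -/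
noncomputable def rdN (f : Nat → Rd) (k : Nat) : Nat → Rd :=
  Nat.rec (motive := fun _ => Nat → Rd) f
    (fun _ ih w ds => unc ds fun d ds => frc (Nat.add (Nat.mul w 16) d) fun w => ih w ds) k

/-- Succeed without consuming anything iff `b`. -/
noncomputable def grd (b : Bool) (ds : List Nat) : Option (List Nat) := sel b (some ds) none

/-- Enumerate the possible sets of new neighbours of `v`. -/
noncomputable def enum (n U A0 v cand : Nat) (f : Nat → Nat → Rd) (m : Nat) :
    Nat → Nat → Nat → Rd :=
  Nat.rec (motive := fun _ => Nat → Nat → Nat → Rd) (fun _ k A ds => f k A ds)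
    (fun j ih S k A ds => sel (Nat.beq k 0) (f 0 A ds)
      (bnd (ih S k A ds) fun ds' =>
        sel (sel (bt cand j) (canon n U A0 S j) false)
          (frc (Nat.lor S (one j)) fun S' => frc (Nat.sub k 1) fun k' =>
            frc (addE A v j) fun A' => ih S' k' A' ds')
          (some ds'))) m

/-- Handle the vertex `v`. -/
noncomputable def branch (n all D P A v : Nat) (f : Nat → Nat → Rd) : Rd := fun ds =>
  sel (sel (Nat.ble n v) false (sel (bt P v) false true))
    (frc (compl (compl all P) (one v)) fun U =>
      frc (mask n fun j => sel (bt U j) (Nat.ble (Nat.succ (pc n (row A j))) D) false) fun cand =>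
      frc (Nat.sub D (pc n (row A v))) fun k => enum n U A v cand f n 0 k A ds)
    none

/-- Digit `i` of `w`. -/
def dg (w i : Nat) : Nat := Nat.mod (Nat.shiftRight w (Nat.mul 4 i)) 16

/-- `a`, `b` are known to be adjacent. -/
def isE (n A a b : Nat) : Bool :=
  and (and (Nat.blt a n) (Nat.blt b n)) (bt (row A a) b)

/-- `a`, `b` are known to be distinct and nonadjacent. -/
def isN (P A a b : Nat) : Bool :=
  and (not (Nat.beq a b)) (and (or (bt P a) (bt P b)) (not (bt (row A a) b)))

/-- The digits of `w` are a known induced `6`-cycle. -/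
def c6chk (n P A w : Nat) : Bool :=
  and (and (and (isE n A (dg w 0) (dg w 1)) (isE n A (dg w 1) (dg w 2)))
    (and (and (isE n A (dg w 2) (dg w 3)) (isE n A (dg w 3) (dg w 4)))
      (and (isE n A (dg w 4) (dg w 5)) (isE n A (dg w 5) (dg w 0)))))
  (and (and (and (isN P A (dg w 0) (dg w 2)) (isN P A (dg w 0) (dg w 3)))
    (and (isN P A (dg w 0) (dg w 4)) (isN P A (dg w 1) (dg w 3))))
    (and (and (isN P A (dg w 1) (dg w 4)) (isN P A (dg w 1) (dg w 5)))
    (and (isN P A (dg w 2) (dg w 4)) (and (isN P A (dg w 2) (dg w 5)) (isN P A (dg w 3) (dg w 5))))))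

/-- The processed vertices form a union of components that misses `u`. -/
noncomputable def dischk (n all P A u : Nat) : Bool :=
  and (and (Nat.blt u n) (and (bt P 0) (not (bt P u))))
    (frc (compl all P) fun un =>
      loop n fun i => sel (bt P i) (Nat.beq (Nat.land (row A i) un) 0) true)

/-- The digits of `w` are an isomorphism from the packed graph `T` to the known graph. -/
noncomputable def isochk (n P A T w : Nat) : Bool :=
  and (Nat.beq n 11) (loop 11 fun i => and (Nat.blt (dg w i) 11) (loop 11 fun j =>
    and (and (bt P (dg w i)) (or (Nat.beq i j) (not (Nat.beq (dg w i) (dg w j)))))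
      (or (and (bt (row A (dg w i)) (dg w j)) (bt (row T i) j))
        (and (not (bt (row A (dg w i)) (dg w j))) (not (bt (row T i) j))))))

/-- Packed `G₁₁`. -/
def tG : Nat := 13884902390092521090332768445625483225634297107102007635709756451061760

/-- Packed `C₁₁`. -/
def tC : Nat := 13830979205723996761389803382457733033416906969745349038391623684194304

/-- The main search, guided by the certificate. -/
noncomputable def run (n all D : Nat) (fuel : Nat) : Nat → Nat → Rd :=
  Nat.rec (motive := fun _ => Nat → Nat → Rd) (fun _ _ _ => none)
    (fun _ ih P A ds => unc ds fun d ds =>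
      sel (Nat.ble d 10)
        (unc ds fun y ds => grd (and (and (Nat.blt d n) (Nat.blt y n)) (dchk n all P A d y)) ds)
      (sel (Nat.beq d 11)
        (unc ds fun v ds => frc (Nat.lor P (one v)) fun P' =>
          branch n all D P A v (fun _ A' ds => ih P' A' ds) ds)
      (sel (Nat.beq d 12)
        (rdN (fun w ds => grd (c6chk n P A w) ds) 6 0 ds)
      (sel (Nat.beq d 13)
        (unc ds fun u ds => grd (dischk n all P A u) ds)
      (sel (Nat.beq d 14)
        (rdN (fun w ds => grd (isochk n P A tG w) ds) 11 0 ds)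
        (rdN (fun w ds => grd (isochk n P A tC w) ds) 11 0 ds)))))) fuel

/-- The search from a root of degree exactly `D`. -/
noncomputable def start (n all D : Nat) : Rd :=
  branch n all D 0 0 0 fun k A ds => sel (Nat.beq k 0) (run n all D 12 1 A ds) (some ds)

/-- Unpack the certificate, `96` hexadecimal digits per entry, lowest digit first. -/
noncomputable def digs (cs : List Nat) : List Nat :=
  List.rec (motive := fun _ => List Nat) [] (fun c _ ih =>
    Nat.rec (motive := fun _ => Nat → List Nat) (fun _ => ih)
      (fun _ ih c => Nat.mod c 16 :: frc (Nat.div c 16) ih) 96 c) cs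

/-- The search succeeds. -/
noncomputable def ok (n D : Nat) (cs : List Nat) : Bool :=
  Option.rec (motive := fun _ => Bool) false (fun _ => true)
    (start n (Nat.sub (Nat.pow 2 n) 1) D (digs cs))


/-! ### Semantics of the basic operations -/

theorem sel_eq {α : Type} (b : Bool) (x y : α) : sel b x y = if b = true then x else y := by
  cases b <;> rfl

theorem frc_eq {α : Type} (x : Nat) (f : Nat → α) : frc x f = f x := by
  cases x <;> rfl

theorem bt_eq (m i : Nat) : bt m i = m.testBit i := by
  rw [Nat.testBit_eq_decide_div_mod_eq, ← Nat.shiftRight_eq_div_pow, Bool.eq_iff_iff,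
    decide_eq_true_eq]
  exact iff_of_eq Nat.beq_eq

theorem testBit_one (i j : Nat) : (one i).testBit j = decide (i = j) := by
  have : one i = 2 ^ i := by
    change 1 <<< i = 2 ^ i
    rw [Nat.shiftLeft_eq, one_mul]
  rw [this, Nat.testBit_two_pow]

theorem testBit_row (A i j : Nat) :
    (row A i).testBit j = (decide (j < 16) && A.testBit (16 * i + 64 + j)) := by
  have : row A i = (A >>> (16 * i + 64)) % 2 ^ 16 := rfl
  rw [this, Nat.testBit_mod_two_pow, Nat.testBit_shiftRight]

theorem testBit_salt (A i : Nat) (hi : 64 ≤ i) : (salt A).testBit i = A.testBit i := by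
  have : salt A = (A >>> 64) <<< 64 ||| A % 2305843009213693951 := rfl
  rw [this, Nat.testBit_or, Nat.testBit_shiftLeft, Nat.testBit_shiftRight]
  have h1 : (A % 2305843009213693951).testBit i = false := by
    apply Nat.testBit_lt_two_pow
    calc A % 2305843009213693951 < 2305843009213693951 := Nat.mod_lt _ (by norm_num)
      _ ≤ 2 ^ 64 := by norm_num
      _ ≤ 2 ^ i := Nat.pow_le_pow_right (by norm_num) hi
  rw [h1, Nat.add_sub_cancel' hi]
  simp [hi]

theorem testBit_lor (a b i : Nat) : (Nat.lor a b).testBit i = (a.testBit i || b.testBit i) :=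
  Nat.testBit_or a b i

theorem testBit_land (a b i : Nat) : (Nat.land a b).testBit i = (a.testBit i && b.testBit i) :=
  Nat.testBit_and a b i

theorem testBit_compl (a m i : Nat) :
    (compl a m).testBit i = (a.testBit i && !m.testBit i) := by
  have : compl a m = a ^^^ (a &&& m) := rfl
  rw [this, Nat.testBit_xor, Nat.testBit_and]
  cases a.testBit i <;> cases m.testBit i <;> rfl

theorem testBit_all (n i : Nat) :
    (Nat.sub (Nat.pow 2 n) 1).testBit i = decide (i < n) :=
  Nat.testBit_two_pow_sub_one n i

theorem testBit_addE (A v w i j : Nat) (hv : v < 16) (hw : w < 16) (hj : j < 16) :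
    (row (addE A v w) i).testBit j = true ↔
      (row A i).testBit j = true ∨ (i = v ∧ j = w) ∨ (i = w ∧ j = v) := by
  rw [testBit_row, testBit_row]
  unfold addE
  rw [frc_eq, testBit_salt _ _ (by omega), testBit_lor, testBit_lor, testBit_one, testBit_one]
  simp only [hj, decide_true, Bool.true_and, Bool.or_eq_true, decide_eq_true_eq]
  have e1 : Nat.add (Nat.add (Nat.mul 16 v) 64) w = 16 * v + 64 + w := rfl
  have e2 : Nat.add (Nat.add (Nat.mul 16 w) 64) v = 16 * w + 64 + v := rfl
  rw [e1, e2]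
  constructor
  · rintro (h | h | h)
    · exact Or.inl h
    · right; left; omega
    · right; right; omega
  · rintro (h | h | h)
    · exact Or.inl h
    · right; left; omega
    · right; right; omega

theorem le1_iff (z : Nat) :
    le1 z = true ↔ ∀ i j, z.testBit i = true → z.testBit j = true → i = j := by
  have h0 : le1 z = true ↔ z &&& (z - 1) = 0 := iff_of_eq Nat.beq_eq
  rw [h0]
  constructor
  · intro h i j hi hj
    have hz : z ≠ 0 := by rintro rfl; simp at hi
    obtain ⟨k, rfl⟩ := (Nat.and_sub_one_eq_zero_iff_isPowerOfTwo hz).1 h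
    rw [Nat.testBit_two_pow] at hi hj
    simp at hi hj
    omega
  · intro h
    by_cases hz : z = 0
    · subst hz; rfl
    · rw [Nat.and_sub_one_eq_zero_iff_isPowerOfTwo hz]
      obtain ⟨i, hi⟩ := Nat.exists_testBit_of_ne_zero hz
      refine ⟨i, Nat.eq_of_testBit_eq fun j => ?_⟩
      rw [Nat.testBit_two_pow]
      by_cases hij : i = j
      · subst hij; simp [hi]
      · simp only [hij, decide_false]
        by_contra hc
        exact hij (h i j hi (by simpa using hc))

theorem loop_iff (n : Nat) (p : Nat → Bool) :
    loop n p = true ↔ ∀ i, i < n → p i = true := by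
  induction n with
  | zero => simp [loop]
  | succ n ih =>
    have : loop (n + 1) p = sel (p n) (loop n p) false := rfl
    rw [this, sel_eq]
    constructor
    · intro h i hi
      by_cases hp : p n = true
      · rw [if_pos hp] at h
        rcases Nat.lt_succ_iff_lt_or_eq.1 hi with h1 | rfl
        · exact ih.1 h i h1
        · exact hp
      · rw [if_neg hp] at h; cases h
    · intro h
      rw [if_pos (h n (Nat.lt_succ_self n))]
      exact ih.2 fun i hi => h i (Nat.lt_succ_of_lt hi)

theorem pc_eq (n x : Nat) :
    pc n x = (Finset.univ.filter fun j : Fin n => x.testBit j = true).card := by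
  rw [Finset.card_filter]
  induction n with
  | zero => rfl
  | succ n ih =>
    have : pc (n + 1) x = pc n x + (x >>> n) % 2 := rfl
    rw [this, ih, Fin.sum_univ_castSucc]
    congr 1
    simp only [Fin.val_last]
    have h := Nat.testBit_eq_decide_div_mod_eq (x := x) (i := n)
    rw [← Nat.shiftRight_eq_div_pow] at h
    simp only [h, decide_eq_true_eq]
    split_ifs <;> omega

theorem testBit_mask (n : Nat) (p : Nat → Bool) (j : Nat) :
    (mask n p).testBit j = true ↔ j < n ∧ p j = true := by
  induction n with
  | zero => simp [mask]
  | succ n ih =>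
    have : mask (n + 1) p = sel (p n) (Nat.lor (one n) (mask n p)) (mask n p) := rfl
    rw [this, sel_eq]
    split_ifs with h
    · rw [testBit_lor, Bool.or_eq_true, ih, testBit_one, decide_eq_true_eq]
      constructor
      · rintro (rfl | ⟨h1, h2⟩)
        · exact ⟨Nat.lt_succ_self _, h⟩
        · exact ⟨Nat.lt_succ_of_lt h1, h2⟩
      · rintro ⟨h1, h2⟩
        rcases Nat.lt_succ_iff_lt_or_eq.1 h1 with h3 | rfl
        · exact Or.inr ⟨h3, h2⟩
        · exact Or.inl rfl
    · rw [ih]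
      constructor
      · rintro ⟨h1, h2⟩
        exact ⟨Nat.lt_succ_of_lt h1, h2⟩
      · rintro ⟨h1, h2⟩
        rcases Nat.lt_succ_iff_lt_or_eq.1 h1 with h3 | rfl
        · exact ⟨h3, h2⟩
        · exact absurd h2 h

theorem bnd_some {x : Option (List Nat)} {f : Rd} {d' : List Nat} (h : bnd x f = some d') :
    ∃ d, x = some d ∧ f d = some d' := by
  cases x with
  | none => cases h
  | some d => exact ⟨d, rfl, h⟩

theorem unc_some {ds : List Nat} {f : Nat → Rd} {d' : List Nat} (h : unc ds f = some d') :
    ∃ d d1, f d d1 = some d' := by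
  cases ds with
  | nil => cases h
  | cons d ds =>
    refine ⟨d, ds, ?_⟩
    have : unc (d :: ds) f = frc d fun d => f d ds := rfl
    rwa [this, frc_eq] at h

theorem rdN_some {f : Nat → Rd} {k w : Nat} {ds d' : List Nat} (h : rdN f k w ds = some d') :
    ∃ w d1, f w d1 = some d' := by
  induction k generalizing w ds with
  | zero => exact ⟨w, ds, h⟩
  | succ k ih =>
    have : rdN f (k + 1) w ds =
      unc ds fun d ds => frc (Nat.add (Nat.mul w 16) d) fun w => rdN f k w ds := rfl
    rw [this] at h
    obtain ⟨d, d1, h⟩ := unc_some h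
    rw [frc_eq] at h
    exact ih h

theorem grd_some {b : Bool} {ds d' : List Nat} (h : grd b ds = some d') : b = true := by
  cases b with
  | false => cases h
  | true => rfl


/-! ### Soundness of the search -/

section Sound

set_option linter.unusedSectionVars false

variable {V : Type*} [Fintype V] {G : SimpleGraph V} [DecidableRel G.Adj] {n : ℕ}

/-- The state `(P, A)` records exactly the edges of `G` with a processed end, in the
labelling `e`. -/
def Compat (G : SimpleGraph V) (e : Fin n ≃ V) (P A : ℕ) : Prop :=
  ∀ i j : Fin n, (row A i).testBit j = true ↔
    (P.testBit i = true ∨ P.testBit j = true) ∧ G.Adj (e i) (e j)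

/-- `j` is a neighbour of `v` that is not processed. -/
def New (G : SimpleGraph V) (e : Fin n ≃ V) (P : ℕ) (v j : Fin n) : Prop :=
  ¬ P.testBit j = true ∧ G.Adj (e v) (e j)

instance (e : Fin n ≃ V) (P : ℕ) (v j : Fin n) : Decidable (New G e P v j) := by
  unfold New; infer_instance

theorem Compat.symm {e : Fin n ≃ V} {P A : ℕ} (h : Compat G e P A) (i j : Fin n) :
    (row A i).testBit j = (row A j).testBit i := by
  rw [Bool.eq_iff_iff, h i j, h j i, or_comm, G.adj_comm]

theorem testBit_P' (P : ℕ) (v i : Fin n) :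
    (Nat.lor P (one v)).testBit i = true ↔ P.testBit i = true ∨ i = v := by
  rw [testBit_lor, Bool.or_eq_true, testBit_one, decide_eq_true_eq]
  exact or_congr Iff.rfl ⟨fun h => (Fin.ext h).symm, fun h => by rw [h]⟩

theorem compat_final {e : Fin n ≃ V} {P A : ℕ} {v : Fin n} {m : ℕ}
    (hm : ∀ j : Fin n, New G e P v j → m ≤ j)
    (hA : ∀ i j : Fin n, (row A i).testBit j = true ↔
      ((P.testBit i = true ∨ P.testBit j = true) ∧ G.Adj (e i) (e j)) ∨
      (i = v ∧ New G e P v j ∧ m ≤ j) ∨ (j = v ∧ New G e P v i ∧ m ≤ i)) :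
    Compat G e (Nat.lor P (one v)) A := by
  intro i j
  rw [hA, testBit_P', testBit_P']
  constructor
  · rintro (⟨h1, h2⟩ | ⟨rfl, h1, -⟩ | ⟨rfl, h1, -⟩)
    · exact ⟨by tauto, h2⟩
    · exact ⟨by tauto, h1.2⟩
    · exact ⟨by tauto, h1.2.symm⟩
  · rintro ⟨h1, h2⟩
    by_cases hi : P.testBit i = true
    · exact Or.inl ⟨Or.inl hi, h2⟩
    by_cases hj : P.testBit j = true
    · exact Or.inl ⟨Or.inr hj, h2⟩
    rcases h1 with (h1 | rfl) | (h1 | rfl)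
    · exact absurd h1 hi
    · have hN : New G e P i j := ⟨hj, h2⟩
      exact Or.inr (Or.inl ⟨rfl, hN, hm j hN⟩)
    · exact absurd h1 hj
    · have hN : New G e P j i := ⟨hi, h2.symm⟩
      exact Or.inr (Or.inr ⟨rfl, hN, hm i hN⟩)

theorem enum_sound (hn : n ≤ 16) {e : Fin n ≃ V} {P A0 U cand : ℕ} {v : Fin n}
    {f : ℕ → ℕ → Rd}
    (hU : ∀ i : Fin n, U.testBit i = true → ¬ P.testBit i = true ∧ i ≠ v)
    (hcand : ∀ j : Fin n, New G e P v j → cand.testBit j = true)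
    (hmin : ∀ i j : Fin n, j < i → New G e P v j → ¬ P.testBit i = true → i ≠ v →
      row A0 i = row A0 j → New G e P v i)
    (m : ℕ) (hm : m ≤ n) : ∀ (S k A : ℕ) (ds ds' : List ℕ),
    (∀ i j : Fin n, (row A i).testBit j = true ↔
      ((P.testBit i = true ∨ P.testBit j = true) ∧ G.Adj (e i) (e j)) ∨
      (i = v ∧ New G e P v j ∧ m ≤ j) ∨ (j = v ∧ New G e P v i ∧ m ≤ i)) →
    (∀ i : Fin n, m ≤ i → New G e P v i → S.testBit i = true) →
    (Finset.univ.filter fun j : Fin n => New G e P v j ∧ (j : ℕ) < m).card ≤ k →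
    enum n U A0 v cand f m S k A ds = some ds' →
    ∃ k' A' d1 d2, f k' A' d1 = some d2 ∧ Compat G e (Nat.lor P (one v)) A' ∧
      k' + (Finset.univ.filter fun j : Fin n => New G e P v j ∧ (j : ℕ) < m).card = k := by
  induction m with
  | zero =>
    intro S k A ds ds' hA hS hk h
    refine ⟨k, A, ds, ds', h, compat_final (fun j _ => Nat.zero_le _) hA, ?_⟩
    simp
  | succ m ih =>
    intro S k A ds ds' hA hS hk h
    have hstep : enum n U A0 v cand f (m + 1) S k A ds = sel (Nat.beq k 0) (f 0 A ds)
      (bnd (enum n U A0 v cand f m S k A ds) fun ds' =>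
        sel (sel (bt cand m) (canon n U A0 S m) false)
          (frc (Nat.lor S (one m)) fun S' => frc (Nat.sub k 1) fun k' =>
            frc (addE A v m) fun A' => enum n U A0 v cand f m S' k' A' ds')
          (some ds')) := rfl
    rw [hstep, sel_eq] at h
    by_cases hk0 : k = 0
    · subst hk0
      rw [if_pos (by rfl)] at h
      have hc := Nat.le_zero.1 hk
      have hno : ∀ j : Fin n, New G e P v j → m + 1 ≤ j := by
        intro j hj
        by_contra hlt
        rw [Finset.card_eq_zero] at hc
        have : j ∈ (Finset.univ.filter fun j : Fin n => New G e P v j ∧ (j : ℕ) < m + 1) := by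
          simp only [Finset.mem_filter, Finset.mem_univ, true_and]
          exact ⟨hj, by omega⟩
        rw [hc] at this
        simp at this
      exact ⟨0, A, ds, ds', h, compat_final hno hA, by omega⟩
    · have hb : ¬ Nat.beq k 0 = true := by rw [Nat.beq_eq]; exact hk0
      rw [if_neg hb] at h
      obtain ⟨d, h1, h2⟩ := bnd_some h
      have hmn : m < n := hm
      set mm : Fin n := ⟨m, hmn⟩ with hmm
      by_cases hN : New G e P v mm
      · -- the vertex `m` is a new neighbour
        have hcd : bt cand m = true := by rw [bt_eq]; exact hcand mm hN
        have hmv : mm ≠ v := by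
          intro hc
          have h3 := hN.2
          rw [hc] at h3
          exact G.loopless.irrefl _ h3
        have hcn : canon n U A0 S m = true := by
          unfold canon
          rw [frc_eq, loop_iff]
          intro i hi
          simp only [sel_eq, bt_eq]
          split_ifs with a1 a2 a3 a4
          · rfl
          · rfl
          · exfalso
            have hmi : m < i := by
              by_contra hc
              exact a1 (Nat.ble_eq_true_of_le (by omega))
            have hu := hU ⟨i, hi⟩ a2
            have h5 := hmin ⟨i, hi⟩ mm hmi hN hu.1 hu.2 (Nat.eq_of_beq_eq_true a4)
            exact a3 (hS ⟨i, hi⟩ hmi h5)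
          · rfl
          · rfl
        rw [hcd, hcn] at h2
        have h3 : enum n U A0 v cand f m (Nat.lor S (one m)) (Nat.sub k 1) (addE A v m) d =
            some ds' := by
          simpa only [sel_eq, frc_eq, if_true] using h2
        have hcard : (Finset.univ.filter fun j : Fin n => New G e P v j ∧ (j : ℕ) < m + 1).card =
            (Finset.univ.filter fun j : Fin n => New G e P v j ∧ (j : ℕ) < m).card + 1 := by
          rw [← Finset.card_insert_of_notMem (a := mm)]
          · congr 1
            ext j
            simp only [Finset.mem_filter, Finset.mem_univ, true_and, Finset.mem_insert]
            constructor
            · rintro ⟨h4, h5⟩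
              by_cases hjm : (j : ℕ) = m
              · exact Or.inl (Fin.ext hjm)
              · exact Or.inr ⟨h4, by omega⟩
            · rintro (rfl | ⟨h4, h5⟩)
              · exact ⟨hN, Nat.lt_succ_self m⟩
              · exact ⟨h4, by omega⟩
          · simp [hmm]
        have hk1 : Nat.sub k 1 = k - 1 := rfl
        rw [hk1] at h3
        obtain ⟨k', A', d1, d2, r1, r2, r3⟩ := ih (by omega) _ _ _ _ _ (by
          intro i j
          rw [testBit_addE A v m i j (by omega) (by omega) (by omega), hA]
          have key : ∀ i : Fin n, (m ≤ (i : ℕ) ↔ m + 1 ≤ (i : ℕ) ∨ i = mm) := by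
            intro i
            rw [hmm, Fin.ext_iff]
            simp only
            omega
          have k1 : ∀ i : Fin n, ((i : ℕ) = m ↔ i = mm) := by
            intro i; rw [hmm, Fin.ext_iff]
          rw [key, key, k1, k1, ← Fin.ext_iff, ← Fin.ext_iff]
          constructor
          · rintro ((h4 | h4 | h4) | h4 | h4)
            · exact Or.inl h4
            · exact Or.inr (Or.inl ⟨h4.1, h4.2.1, Or.inl h4.2.2⟩)
            · exact Or.inr (Or.inr ⟨h4.1, h4.2.1, Or.inl h4.2.2⟩)
            · exact Or.inr (Or.inl ⟨h4.1, by rw [h4.2]; exact hN, Or.inr h4.2⟩)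
            · exact Or.inr (Or.inr ⟨h4.2, by rw [h4.1]; exact hN, Or.inr h4.1⟩)
          · rintro (h4 | ⟨h4, h5, h6 | h6⟩ | ⟨h4, h5, h6 | h6⟩)
            · exact Or.inl (Or.inl h4)
            · exact Or.inl (Or.inr (Or.inl ⟨h4, h5, h6⟩))
            · exact Or.inr (Or.inl ⟨h4, h6⟩)
            · exact Or.inl (Or.inr (Or.inr ⟨h4, h5, h6⟩))
            · exact Or.inr (Or.inr ⟨h6, h4⟩)) (by
          intro i hi hNi
          rw [testBit_lor, Bool.or_eq_true, testBit_one, decide_eq_true_eq]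
          by_cases him : m = i
          · exact Or.inr him
          · exact Or.inl (hS i (by omega) hNi)) (by omega) h3
        exact ⟨k', A', d1, d2, r1, r2, by omega⟩
      · have hfil : (Finset.univ.filter fun j : Fin n => New G e P v j ∧ (j : ℕ) < m + 1) =
            (Finset.univ.filter fun j : Fin n => New G e P v j ∧ (j : ℕ) < m) := by
          ext j
          simp only [Finset.mem_filter, Finset.mem_univ, true_and]
          refine and_congr_right fun hj => ?_
          have : (j : ℕ) ≠ m := by
            intro hc
            exact hN (by rw [show mm = j from Fin.ext hc.symm]; exact hj)
          omega
        rw [hfil] at hk ⊢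
        have key : ∀ j : Fin n, New G e P v j → (m + 1 ≤ (j : ℕ) ↔ m ≤ (j : ℕ)) := by
          intro j hj
          have : (j : ℕ) ≠ m := by
            intro hc
            exact hN (by rw [show mm = j from Fin.ext hc.symm]; exact hj)
          omega
        refine ih (by omega) S k A ds d ?_ ?_ hk h1
        · intro i j
          rw [hA]
          refine or_congr Iff.rfl (or_congr ?_ ?_)
          · exact and_congr_right fun _ => and_congr_right fun h => key _ h
          · exact and_congr_right fun _ => and_congr_right fun h => key _ h
        · intro i hi hNi
          exact hS i ((key i hNi).2 hi) hNi

/-- We may relabel so that larger twins are preferred. -/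
theorem exists_min {P A : ℕ} {v : Fin n} (hv : ¬ P.testBit v = true) (M : ℕ) :
    ∀ e : Fin n ≃ V, Compat G e P A →
    (∑ w : V, if G.Adj (e v) w then n - (e.symm w : ℕ) else 0) = M →
    ∃ e' : Fin n ≃ V, e' v = e v ∧ Compat G e' P A ∧
      ∀ i j : Fin n, j < i → New G e' P v j → ¬ P.testBit i = true → i ≠ v →
        row A i = row A j → New G e' P v i := by
  induction M using Nat.strong_induction_on with
  | _ M ih =>
    intro e he hM
    by_cases hgood : ∀ i j : Fin n, j < i → New G e P v j → ¬ P.testBit i = true → i ≠ v →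
        row A i = row A j → New G e P v i
    · exact ⟨e, rfl, he, hgood⟩
    · push Not at hgood
      obtain ⟨i, j, hji, hNj, hPi, hiv, hrow, hNi⟩ := hgood
      have hnadj : ¬ G.Adj (e v) (e i) := fun h => hNi ⟨by simpa using hPi, h⟩
      have hjv : j ≠ v := by
        rintro rfl
        exact G.loopless.irrefl _ hNj.2
      have hPi' : P.testBit i = false := by simpa using hPi
      have hPj' : P.testBit j = false := by simpa using hNj.1
      have hev : ((Equiv.swap i j).trans e) v = e v := by
        simp [Equiv.swap_apply_of_ne_of_ne hiv.symm hjv.symm]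
      have hrσ : ∀ a : Fin n, row A (Equiv.swap i j a : Fin n) = row A a := by
        intro a
        by_cases h1 : a = i
        · rw [h1, Equiv.swap_apply_left, hrow]
        by_cases h2 : a = j
        · rw [h2, Equiv.swap_apply_right, hrow]
        rw [Equiv.swap_apply_of_ne_of_ne h1 h2]
      have hPσ : ∀ a : Fin n, P.testBit (Equiv.swap i j a : Fin n) = P.testBit a := by
        intro a
        by_cases h1 : a = i
        · rw [h1, Equiv.swap_apply_left, hPi', hPj']
        by_cases h2 : a = j
        · rw [h2, Equiv.swap_apply_right, hPi', hPj']
        rw [Equiv.swap_apply_of_ne_of_ne h1 h2]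
      have hC : Compat G ((Equiv.swap i j).trans e) P A := by
        intro a b
        have h1 := he (Equiv.swap i j a) (Equiv.swap i j b)
        rw [hPσ, hPσ, hrσ, he.symm, hrσ, ← he.symm] at h1
        exact h1
      have hlt : (∑ w : V, if G.Adj (((Equiv.swap i j).trans e) v) w then
          n - (((Equiv.swap i j).trans e).symm w : ℕ) else 0) < M := by
        rw [hev, ← hM]
        apply Finset.sum_lt_sum
        · intro w _
          split_ifs with hw
          · have hwi : e.symm w ≠ i := by
              rintro rfl
              apply hnadj
              simpa using hw
            by_cases hwj : e.symm w = j
            · simp only [Equiv.symm_trans_apply, Equiv.symm_swap, hwj, Equiv.swap_apply_right]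
              have : (j : ℕ) < i := hji
              omega
            · simp only [Equiv.symm_trans_apply, Equiv.symm_swap]
              rw [Equiv.swap_apply_of_ne_of_ne hwi hwj]
          · exact le_refl _
        · refine ⟨e j, Finset.mem_univ _, ?_⟩
          rw [if_pos hNj.2, if_pos hNj.2]
          simp only [Equiv.symm_trans_apply, Equiv.symm_swap, Equiv.symm_apply_apply,
            Equiv.swap_apply_right]
          have : (j : ℕ) < i := hji
          omega
      obtain ⟨e', r1, r2, r3⟩ := ih _ hlt _ hC rfl
      exact ⟨e', r1.trans hev, r2, r3⟩

theorem degree_eq (e : Fin n ≃ V) (v : Fin n) :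
    G.degree (e v) = (Finset.univ.filter fun j : Fin n => G.Adj (e v) (e j)).card := by
  rw [← G.card_neighborFinset_eq_degree, ← Finset.card_map e.symm.toEmbedding]
  congr 1
  ext j
  simp

theorem branch_sound (hn : n ≤ 16) {D P A v : ℕ} {e : Fin n ≃ V} {f : ℕ → ℕ → Rd}
    {ds ds' : List ℕ} (hdeg : ∀ w, G.degree w ≤ D) (he : Compat G e P A)
    (h : branch n (Nat.sub (Nat.pow 2 n) 1) D P A v f ds = some ds') :
    ∃ hv : v < n, ∃ (e' : Fin n ≃ V) (k' A' : ℕ) (d1 d2 : List ℕ), e' ⟨v, hv⟩ = e ⟨v, hv⟩ ∧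
      f k' A' d1 = some d2 ∧ Compat G e' (Nat.lor P (one v)) A' ∧
      k' + G.degree (e ⟨v, hv⟩) = D := by
  unfold branch at h
  rw [sel_eq] at h
  split_ifs at h with hc
  have hv : v < n := by
    by_contra hcon
    rw [sel_eq, if_pos (Nat.ble_eq_true_of_le (by omega))] at hc
    cases hc
  have hPv : ¬ P.testBit v = true := by
    intro hcon
    rw [sel_eq, sel_eq, bt_eq, hcon] at hc
    simp at hc
  simp only [frc_eq] at h
  obtain ⟨vv, rfl⟩ : ∃ vv : Fin n, (vv : ℕ) = v := ⟨⟨v, hv⟩, rfl⟩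
  obtain ⟨e', r1, r2, r3⟩ := exists_min (v := vv) hPv _ e he rfl
  have hpc : ∀ j : Fin n, ¬ P.testBit j = true → pc n (row A j) =
      (Finset.univ.filter fun i : Fin n => P.testBit i = true ∧ G.Adj (e' j) (e' i)).card := by
    intro j hj
    rw [pc_eq]
    congr 1
    ext i
    simp only [Finset.mem_filter, Finset.mem_univ, true_and]
    rw [r2 j i]
    simp [hj]
  have hsum : pc n (row A vv) +
      (Finset.univ.filter fun j : Fin n => New G e' P vv j ∧ (j : ℕ) < n).card =
      G.degree (e vv) := by
    rw [← r1, degree_eq, hpc vv hPv,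
      ← Finset.card_union_of_disjoint]
    · congr 1
      ext i
      simp only [Finset.mem_union, Finset.mem_filter, Finset.mem_univ, true_and, i.isLt,
        and_true]
      unfold New
      tauto
    · rw [Finset.disjoint_left]
      intro i hi hi'
      simp only [Finset.mem_filter, Finset.mem_univ, true_and] at hi hi'
      exact hi'.1.1 hi.1
  have hd := hdeg (e vv)
  have hkk : Nat.sub D (pc n (row A vv)) = D - pc n (row A vv) := rfl
  obtain ⟨k', A', d1, d2, s1, s2, s3⟩ := enum_sound (G := G) (v := vv) (e := e') (P := P) hn (by
      intro i hi
      rw [testBit_compl, testBit_compl, testBit_one] at hi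
      simp only [Bool.and_eq_true, Bool.not_eq_true', decide_eq_false_iff_not] at hi
      refine ⟨by simp [hi.1.2], fun hcon => hi.2 (by rw [hcon])⟩) (by
      intro j hj
      rw [testBit_mask]
      refine ⟨j.isLt, ?_⟩
      have hjv : j ≠ vv := by
        intro hcon
        have := hj.2
        rw [hcon] at this
        exact G.loopless.irrefl _ this
      have hUj : bt (compl (compl (Nat.sub (Nat.pow 2 n) 1) P) (one vv)) j = true := by
        rw [bt_eq, testBit_compl, testBit_compl, testBit_one, testBit_all]
        have h1 : (vv : ℕ) ≠ j := fun hcon => hjv (Fin.ext hcon.symm)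
        have h2 := hj.1
        simp only [Bool.not_eq_true] at h2
        simp [h1, h2]
      rw [sel_eq, if_pos hUj, Nat.ble_eq, hpc j hj.1]
      refine le_trans ?_ (hdeg (e' j))
      rw [degree_eq]
      apply Finset.card_lt_card
      rw [Finset.ssubset_iff_of_subset]
      · refine ⟨vv, ?_, ?_⟩
        · simp only [Finset.mem_filter, Finset.mem_univ, true_and]
          exact hj.2.symm
        · simp only [Finset.mem_filter, Finset.mem_univ, true_and]
          exact fun hcon => hPv hcon.1
      · intro i hi
        simp only [Finset.mem_filter, Finset.mem_univ, true_and] at hi ⊢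
        exact hi.2) r3 n le_rfl _ _ _ _ _ (by
      intro i j
      rw [r2 i j]
      have h1 := i.isLt
      have h2 := j.isLt
      constructor
      · exact Or.inl
      · rintro (h3 | h3 | h3)
        · exact h3
        · omega
        · omega) (by
      intro i hi
      have h1 := i.isLt
      omega) (by omega) h
  have hfin : k' + G.degree (e vv) = D := by omega
  exact ⟨hv, e', k', A', d1, d2, r1, s1, s2, hfin⟩


theorem iota_le (x y : V)
    (h : ∀ a c b : V, a ≠ b → G.Adj a c → G.Adj c b →
      (∀ w, w = a ∨ w = c ∨ w = b → w ≠ x ∧ w ≠ y ∧ ¬ G.Adj x w ∧ ¬ G.Adj y w) → False) :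
    iotaP3 G ≤ 2 := by
  classical
  refine le_trans (Nat.sInf_le ⟨{x, y}, rfl, ?_⟩) Finset.card_le_two
  rintro ⟨f, hf, hadj⟩
  have h01 : (SimpleGraph.pathGraph 3).Adj 0 1 := by
    rw [SimpleGraph.pathGraph_adj]; simp
  have h12 : (SimpleGraph.pathGraph 3).Adj 1 2 := by
    rw [SimpleGraph.pathGraph_adj]; simp
  refine h (f 0) (f 1) (f 2) ?_ (hadj _ _ h01) (hadj _ _ h12) ?_
  · intro hc
    have := hf (Subtype.ext hc)
    simp at this
  · have key : ∀ i : Fin 3, (f i : V) ≠ x ∧ (f i : V) ≠ y ∧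
        ¬ G.Adj x (f i) ∧ ¬ G.Adj y (f i) := by
      intro i
      have hi := (f i).2
      simp only [closedNbhd, Set.mem_compl_iff, Set.mem_ofPred_eq, Finset.coe_insert,
        Finset.coe_singleton, Set.mem_insert_iff, Set.mem_singleton_iff, exists_eq_or_imp,
        exists_eq_left] at hi
      tauto
    rintro w (rfl | rfl | rfl)
    · exact key 0
    · exact key 1
    · exact key 2

theorem dchk_sound {e : Fin n ≃ V} {P A : ℕ} (he : Compat G e P A)
    (hdeg : ∀ w, G.degree w ≤ 3) (x y : Fin n)
    (h : dchk n (Nat.sub (Nat.pow 2 n) 1) P A x y = true) : iotaP3 G ≤ 2 := by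
  unfold dchk at h
  simp only [frc_eq, loop_iff, sel_eq, bt_eq] at h
  set cov := Nat.land (Nat.sub (Nat.pow 2 n) 1)
    (Nat.lor (Nat.lor (row A x) (row A y)) (Nat.lor (one x) (one y))) with hcov
  have hcovb : ∀ i : Fin n, cov.testBit i = true →
      i = x ∨ i = y ∨ G.Adj (e x) (e i) ∨ G.Adj (e y) (e i) := by
    intro i hi
    rw [hcov, testBit_land, testBit_lor, testBit_lor, testBit_lor, testBit_one,
      testBit_one] at hi
    simp only [Bool.and_eq_true, Bool.or_eq_true, decide_eq_true_eq] at hi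
    rcases hi.2 with (hi | hi) | (hi | hi)
    · exact Or.inr (Or.inr (Or.inl ((he x i).1 hi).2))
    · exact Or.inr (Or.inr (Or.inr ((he y i).1 hi).2))
    · exact Or.inl (Fin.ext hi.symm)
    · exact Or.inr (Or.inl (Fin.ext hi.symm))
  apply iota_le (e x) (e y)
  intro a c b hab hac hcb hout
  have hnc : ∀ i : Fin n, e i = a ∨ e i = c ∨ e i = b → cov.testBit i = false := by
    intro i hi
    by_contra hc
    have h1 := hout _ hi
    rcases hcovb i (by simpa using hc) with h2 | h2 | h2 | h2
    · exact h1.1 (by rw [h2])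
    · exact h1.2.1 (by rw [h2])
    · exact h1.2.2.1 h2
    · exact h1.2.2.2 h2
  obtain ⟨a, rfl⟩ := e.surjective a
  obtain ⟨b, rfl⟩ := e.surjective b
  obtain ⟨c, rfl⟩ := e.surjective c
  have hrem : ∀ i : Fin n, cov.testBit i = false →
      (compl (Nat.sub (Nat.pow 2 n) 1) cov).testBit i = true := by
    intro i hi
    rw [testBit_compl, testBit_all, hi]
    simp
  have ha := hnc a (Or.inl rfl)
  have hb := hnc b (Or.inr (Or.inr rfl))
  have hc := hnc c (Or.inr (Or.inl rfl))
  have h1 := h c c.isLt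
  rw [if_pos (hrem c hc)] at h1
  have hab' : (a : ℕ) ≠ b := fun hcon => hab (by rw [Fin.ext hcon])
  have hup : ∀ i : Fin n, cov.testBit i = false → G.Adj (e c) (e i) →
      (Nat.land (Nat.lor (row A c) (if P.testBit c = true then 0 else
        compl (compl (Nat.sub (Nat.pow 2 n) 1) P) (one c)))
        (compl (Nat.sub (Nat.pow 2 n) 1) cov)).testBit i = true := by
    intro i hi hadj
    rw [testBit_land, testBit_lor, hrem i hi, Bool.and_true, Bool.or_eq_true]
    by_cases hP : P.testBit c = true ∨ P.testBit i = true
    · exact Or.inl ((he c i).2 ⟨hP, hadj⟩)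
    · push Not at hP
      right
      rw [if_neg hP.1, testBit_compl, testBit_compl, testBit_all, testBit_one]
      have h3 : (c : ℕ) ≠ i := by
        intro hcon
        have : c = i := Fin.ext hcon
        rw [this] at hadj
        exact G.loopless.irrefl _ hadj
      have h4 : P.testBit i = false := by simpa using hP.2
      simp [h3, h4]
  generalize Nat.land (Nat.lor (row A c) (if P.testBit c = true then 0 else
        compl (compl (Nat.sub (Nat.pow 2 n) 1) P) (one c)))
        (compl (Nat.sub (Nat.pow 2 n) 1) cov) = Z at h1 hup
  by_cases c1 : le1 Z = true
  · exact hab' ((le1_iff _).1 c1 a b (hup a ha hac.symm) (hup b hb hcb))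
  rw [if_neg c1] at h1
  by_cases c2 : le1 (Nat.land (row A c) cov) = true
  · rw [if_pos c2] at h1
    cases h1
  · rw [le1_iff] at c2
    push Not at c2
    obtain ⟨i, j, hi, hj, hij⟩ := c2
    have hlt : ∀ i : ℕ, cov.testBit i = true → i < n := by
      intro i hi
      rw [hcov, testBit_land, testBit_all, Bool.and_eq_true, decide_eq_true_eq] at hi
      exact hi.1
    rw [testBit_land, Bool.and_eq_true] at hi hj
    obtain ⟨i, rfl⟩ : ∃ k : Fin n, (k : ℕ) = i := ⟨⟨i, hlt i hi.2⟩, rfl⟩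
    obtain ⟨j, rfl⟩ : ∃ k : Fin n, (k : ℕ) = j := ⟨⟨j, hlt j hj.2⟩, rfl⟩
    have hd := hdeg (e c)
    rw [degree_eq] at hd
    have hne : ∀ s t : Fin n, cov.testBit s = true → cov.testBit t = false → s ≠ t := by
      rintro s t hs ht rfl
      rw [hs] at ht
      cases ht
    have hcard : ({i, j, a, b} : Finset (Fin n)).card = 4 := by
      have hij' : i ≠ j := fun hcon => hij (by rw [hcon])
      have hab'' : a ≠ b := fun hcon => hab (by rw [hcon])
      have g1 := hne i a hi.2 ha
      have g2 := hne i b hi.2 hb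
      have g3 := hne j a hj.2 ha
      have g4 := hne j b hj.2 hb
      rw [Finset.card_insert_of_notMem (by simp [hij', g1, g2]),
        Finset.card_insert_of_notMem (by simp [g3, g4]),
        Finset.card_insert_of_notMem (by simp [hab'']), Finset.card_singleton]
    have hsub : ({i, j, a, b} : Finset (Fin n)) ⊆
        (Finset.univ.filter fun j : Fin n => G.Adj (e c) (e j)) := by
      intro s hs
      simp only [Finset.mem_insert, Finset.mem_singleton] at hs
      simp only [Finset.mem_filter, Finset.mem_univ, true_and]
      rcases hs with rfl | rfl | rfl | rfl
      · exact ((he _ _).1 hi.1).2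
      · exact ((he _ _).1 hj.1).2
      · exact hac.symm
      · exact hcb
    have := Finset.card_le_card hsub
    omega

theorem isE_adj {e : Fin n ≃ V} {P A a b : ℕ} (he : Compat G e P A)
    (h : isE n A a b = true) : ∃ (ha : a < n) (hb : b < n), G.Adj (e ⟨a, ha⟩) (e ⟨b, hb⟩) := by
  unfold isE at h
  simp only [Bool.and_eq_true, bt_eq, Nat.blt_eq] at h
  exact ⟨h.1.1, h.1.2, ((he ⟨a, h.1.1⟩ ⟨b, h.1.2⟩).1 h.2).2⟩

theorem isN_nadj {e : Fin n ≃ V} {P A a b : ℕ} (he : Compat G e P A)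
    (h : isN P A a b = true) (ha : a < n) (hb : b < n) :
    a ≠ b ∧ ¬ G.Adj (e ⟨a, ha⟩) (e ⟨b, hb⟩) := by
  unfold isN at h
  simp only [Bool.and_eq_true, bt_eq, Bool.not_eq_true', Bool.or_eq_true] at h
  refine ⟨fun hcon => ?_, fun hcon => ?_⟩
  · have := h.1
    rw [hcon, Nat.beq_refl] at this
    cases this
  · have := (he ⟨a, ha⟩ ⟨b, hb⟩).2 ⟨h.2.1, hcon⟩
    rw [h.2.2] at this
    cases this

theorem c6chk_sound {e : Fin n ≃ V} {P A w : ℕ} (he : Compat G e P A)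
    (h : c6chk n P A w = true) : hasInducedC6 G := by
  unfold c6chk at h
  simp only [Bool.and_eq_true] at h
  obtain ⟨⟨⟨e01, e12⟩, ⟨e23, e34⟩, e45, e50⟩,
    ⟨⟨n02, n03⟩, n04, n13⟩, ⟨n14, n15⟩, n24, n25, n35⟩ := h
  obtain ⟨h0, h1, e01⟩ := isE_adj he e01
  obtain ⟨_, h2, e12⟩ := isE_adj he e12
  obtain ⟨_, h3, e23⟩ := isE_adj he e23
  obtain ⟨_, h4, e34⟩ := isE_adj he e34
  obtain ⟨_, h5, e45⟩ := isE_adj he e45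
  obtain ⟨_, _, e50⟩ := isE_adj he e50
  have n02 := isN_nadj he n02 h0 h2
  have n03 := isN_nadj he n03 h0 h3
  have n04 := isN_nadj he n04 h0 h4
  have n13 := isN_nadj he n13 h1 h3
  have n14 := isN_nadj he n14 h1 h4
  have n15 := isN_nadj he n15 h1 h5
  have n24 := isN_nadj he n24 h2 h4
  have n25 := isN_nadj he n25 h2 h5
  have n35 := isN_nadj he n35 h3 h5
  have cyc : ∀ a b : Fin 6, (SimpleGraph.cycleGraph 6).Adj a b ↔ (a - b = 1 ∨ b - a = 1) :=
    fun a b => SimpleGraph.cycleGraph_adj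
  have ne : ∀ {a b : ℕ} {ha : a < n} {hb : b < n}, a ≠ b → e ⟨a, ha⟩ ≠ e ⟨b, hb⟩ := by
    intro a b ha hb hab hcon
    exact hab (by simpa using e.injective hcon)
  have H : ∀ a b : Fin 6, a < b →
      (![e ⟨_, h0⟩, e ⟨_, h1⟩, e ⟨_, h2⟩, e ⟨_, h3⟩, e ⟨_, h4⟩, e ⟨_, h5⟩] a ≠
        ![e ⟨_, h0⟩, e ⟨_, h1⟩, e ⟨_, h2⟩, e ⟨_, h3⟩, e ⟨_, h4⟩, e ⟨_, h5⟩] b) ∧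
      (G.Adj (![e ⟨_, h0⟩, e ⟨_, h1⟩, e ⟨_, h2⟩, e ⟨_, h3⟩, e ⟨_, h4⟩, e ⟨_, h5⟩] a)
        (![e ⟨_, h0⟩, e ⟨_, h1⟩, e ⟨_, h2⟩, e ⟨_, h3⟩, e ⟨_, h4⟩, e ⟨_, h5⟩] b) ↔
      (SimpleGraph.cycleGraph 6).Adj a b) := by
    intro a b hab
    rw [cyc]
    fin_cases a <;> fin_cases b <;> first | exact absurd hab (by decide) | skip
    · exact ⟨e01.ne, iff_of_true e01 (by decide)⟩
    · exact ⟨ne n02.1, iff_of_false n02.2 (by decide)⟩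
    · exact ⟨ne n03.1, iff_of_false n03.2 (by decide)⟩
    · exact ⟨ne n04.1, iff_of_false n04.2 (by decide)⟩
    · exact ⟨e50.symm.ne, iff_of_true e50.symm (by decide)⟩
    · exact ⟨e12.ne, iff_of_true e12 (by decide)⟩
    · exact ⟨ne n13.1, iff_of_false n13.2 (by decide)⟩
    · exact ⟨ne n14.1, iff_of_false n14.2 (by decide)⟩
    · exact ⟨ne n15.1, iff_of_false n15.2 (by decide)⟩
    · exact ⟨e23.ne, iff_of_true e23 (by decide)⟩
    · exact ⟨ne n24.1, iff_of_false n24.2 (by decide)⟩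
    · exact ⟨ne n25.1, iff_of_false n25.2 (by decide)⟩
    · exact ⟨e34.ne, iff_of_true e34 (by decide)⟩
    · exact ⟨ne n35.1, iff_of_false n35.2 (by decide)⟩
    · exact ⟨e45.ne, iff_of_true e45 (by decide)⟩
  refine ⟨![e ⟨_, h0⟩, e ⟨_, h1⟩, e ⟨_, h2⟩, e ⟨_, h3⟩, e ⟨_, h4⟩, e ⟨_, h5⟩], ?_, ?_⟩
  · intro a b hab
    rcases lt_trichotomy a b with hlt | rfl | hlt
    · exact absurd hab (H a b hlt).1
    · rfl
    · exact absurd hab.symm (H b a hlt).1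
  · intro a b
    rcases lt_trichotomy a b with hlt | rfl | hlt
    · exact (H a b hlt).2
    · exact iff_of_false (G.loopless.irrefl _) (SimpleGraph.loopless _ |>.irrefl _)
    · rw [G.adj_comm, (SimpleGraph.cycleGraph 6).adj_comm]
      exact (H b a hlt).2

theorem dischk_sound {e : Fin n ≃ V} {P A u : ℕ} (he : Compat G e P A) (hconn : G.Connected)
    (h : dischk n (Nat.sub (Nat.pow 2 n) 1) P A u = true) : False := by
  unfold dischk at h
  simp only [Bool.and_eq_true, bt_eq, Nat.blt_eq, Bool.not_eq_true', frc_eq, loop_iff,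
    sel_eq] at h
  obtain ⟨⟨hu, h0, hPu⟩, hl⟩ := h
  have hclosed : ∀ w w' : V, G.Adj w w' → P.testBit (e.symm w) = true →
      P.testBit (e.symm w') = true := by
    intro w w' hadj hw
    have h1 := hl (e.symm w) (e.symm w).isLt
    rw [if_pos hw] at h1
    have h2 := Nat.eq_of_beq_eq_true h1
    by_contra hcon
    have h3 : (Nat.land (row A (e.symm w)) (compl (Nat.sub (Nat.pow 2 n) 1) P)).testBit
        (e.symm w') = true := by
      rw [testBit_land, Bool.and_eq_true, testBit_compl, testBit_all]
      refine ⟨(he _ _).2 ⟨Or.inl hw, by simpa using hadj⟩, ?_⟩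
      have : P.testBit (e.symm w') = false := by simpa using hcon
      simp [this]
    rw [h2] at h3
    simp at h3
  have hreach : ∀ w w' : V, G.Walk w w' → P.testBit (e.symm w) = true →
      P.testBit (e.symm w') = true := by
    intro w w' p
    induction p with
    | nil => exact id
    | cons hadj _ ih => exact fun hw => ih (hclosed _ _ hadj hw)
  have hn0 : 0 < n := by omega
  obtain ⟨p⟩ := hconn.preconnected (e ⟨0, hn0⟩) (e ⟨u, hu⟩)
  have := hreach _ _ p (by simpa using h0)
  simp [hPu] at this

theorem isochk_sound {e : Fin n ≃ V} {P A T w : ℕ} (he : Compat G e P A)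
    (H : SimpleGraph (Fin 11))
    (hT : ∀ i j : Fin 11, (row T i).testBit j = true ↔ H.Adj i j)
    (h : isochk n P A T w = true) : Nonempty (G ≃g H) := by
  unfold isochk at h
  simp only [Bool.and_eq_true, bt_eq, Nat.blt_eq, loop_iff] at h
  obtain ⟨hn, h⟩ := h
  obtain rfl : n = 11 := Nat.eq_of_beq_eq_true hn
  have hinj : Function.Injective fun i : Fin 11 => (⟨dg w i, (h i i.isLt).1⟩ : Fin 11) := by
    intro i j hij
    have h1 := ((h i i.isLt).2 j j.isLt).1.2
    simp only [Fin.mk.injEq] at hij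
    rw [hij, Nat.beq_refl] at h1
    simp only [Bool.not_true, Bool.or_false] at h1
    exact Fin.ext (Nat.eq_of_beq_eq_true h1)
  let q : Fin 11 ≃ Fin 11 := Equiv.ofBijective _ (Finite.injective_iff_bijective.1 hinj)
  refine ⟨SimpleGraph.Iso.symm ⟨q.trans e, ?_⟩⟩
  intro i j
  have h1 := (h i i.isLt).2 j j.isLt
  have h2 := he (q i) (q j)
  have hq : ∀ i, ((q i : Fin 11) : ℕ) = dg w i := fun i => rfl
  rw [hq, hq] at h2
  rw [← hT]
  simp only [Equiv.trans_apply]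
  have h3 := h1.2
  have h4 := h1.1.1
  simp only [Bool.or_eq_true, Bool.and_eq_true, Bool.not_eq_true'] at h3
  constructor
  · intro hadj
    have h5 := h2.2 ⟨Or.inl h4, hadj⟩
    rcases h3 with h3 | h3
    · exact h3.2
    · rw [h5] at h3; cases h3.1
  · intro ht
    rcases h3 with h3 | h3
    · exact (h2.1 h3.1).2
    · rw [ht] at h3; cases h3.2

theorem tC_spec (i j : Fin 11) :
    (row tC i).testBit j = true ↔ (SimpleGraph.cycleGraph 11).Adj i j := by
  rw [SimpleGraph.cycleGraph_adj]
  revert i j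
  decide +kernel

theorem tG_spec (i j : Fin 11) : (row tG i).testBit j = true ↔ G11graph.Adj i j := by
  unfold G11graph
  rw [SimpleGraph.fromRel_adj]
  revert i j
  decide +kernel

theorem run_sound (hn : n ≤ 16) (D : ℕ) (hdeg : ∀ w, G.degree w ≤ D) (hD : D ≤ 3)
    (hconn : G.Connected) (hc6 : ¬ hasInducedC6 G)
    (hc11 : ¬ Nonempty (G ≃g SimpleGraph.cycleGraph 11))
    (hg11 : ¬ Nonempty (G ≃g G11graph)) (fuel : ℕ) :
    ∀ (P A : ℕ) (ds ds' : List ℕ) (e : Fin n ≃ V), Compat G e P A →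
      run n (Nat.sub (Nat.pow 2 n) 1) D fuel P A ds = some ds' → iotaP3 G ≤ 2 := by
  induction fuel with
  | zero => intro P A ds ds' e he h; cases h
  | succ fuel ih =>
    intro P A ds ds' e he h
    have hstep : run n (Nat.sub (Nat.pow 2 n) 1) D (fuel + 1) P A ds =
      unc ds fun d ds =>
      sel (Nat.ble d 10)
        (unc ds fun y ds => grd (and (and (Nat.blt d n) (Nat.blt y n))
          (dchk n (Nat.sub (Nat.pow 2 n) 1) P A d y)) ds)
      (sel (Nat.beq d 11)
        (unc ds fun v ds => frc (Nat.lor P (one v)) fun P' =>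
          branch n (Nat.sub (Nat.pow 2 n) 1) D P A v
            (fun _ A' ds => run n (Nat.sub (Nat.pow 2 n) 1) D fuel P' A' ds) ds)
      (sel (Nat.beq d 12)
        (rdN (fun w ds => grd (c6chk n P A w) ds) 6 0 ds)
      (sel (Nat.beq d 13)
        (unc ds fun u ds => grd (dischk n (Nat.sub (Nat.pow 2 n) 1) P A u) ds)
      (sel (Nat.beq d 14)
        (rdN (fun w ds => grd (isochk n P A tG w) ds) 11 0 ds)
        (rdN (fun w ds => grd (isochk n P A tC w) ds) 11 0 ds))))) := rfl
    rw [hstep] at h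
    obtain ⟨d, d1, h⟩ := unc_some h
    simp only [sel_eq] at h
    split_ifs at h
    · obtain ⟨y, d2, h⟩ := unc_some h
      have h := grd_some h
      simp only [Bool.and_eq_true, Nat.blt_eq] at h
      exact dchk_sound he (fun w => (hdeg w).trans hD) ⟨d, h.1.1⟩ ⟨y, h.1.2⟩ h.2
    · obtain ⟨v, d2, h⟩ := unc_some h
      rw [frc_eq] at h
      obtain ⟨hv, e', k', A', d3, d4, -, h2, h3, -⟩ := branch_sound hn hdeg he h
      exact ih _ _ _ _ e' h3 h2
    · obtain ⟨w, d2, h⟩ := rdN_some h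
      exact absurd (c6chk_sound he (grd_some h)) hc6
    · obtain ⟨u, d2, h⟩ := unc_some h
      exact (dischk_sound he hconn (grd_some h)).elim
    · obtain ⟨w, d2, h⟩ := rdN_some h
      exact absurd (isochk_sound he _ tG_spec (grd_some h)) hg11
    · obtain ⟨w, d2, h⟩ := rdN_some h
      exact absurd (isochk_sound he _ tC_spec (grd_some h)) hc11

theorem ok_sound (hn0 : 0 < n) (hn : n ≤ 16) (hV : Fintype.card V = n) (v : V)
    (hmax : ∀ w, G.degree w ≤ G.degree v) (hD : G.degree v ≤ 3)
    (hconn : G.Connected) (hc6 : ¬ hasInducedC6 G)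
    (hc11 : ¬ Nonempty (G ≃g SimpleGraph.cycleGraph 11))
    (hg11 : ¬ Nonempty (G ≃g G11graph)) (cs : List ℕ) (h : ok n (G.degree v) cs = true) :
    iotaP3 G ≤ 2 := by
  obtain ⟨ds', h⟩ : ∃ ds', start n (Nat.sub (Nat.pow 2 n) 1) (G.degree v) (digs cs) =
      some ds' := by
    unfold ok at h
    cases hs : start n (Nat.sub (Nat.pow 2 n) 1) (G.degree v) (digs cs) with
    | none => rw [hs] at h; cases h
    | some d => exact ⟨d, rfl⟩
  classical
  let e0 : Fin n ≃ V := (Fintype.equivFinOfCardEq hV).symm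
  let e : Fin n ≃ V := e0.trans (Equiv.swap (e0 ⟨0, hn0⟩) v)
  have hev : e ⟨0, hn0⟩ = v := by simp [e]
  have he : Compat G e 0 0 := by
    intro i j
    rw [testBit_row]
    simp
  obtain ⟨hv, e', k', A', d1, d2, -, r2, r3, r4⟩ := branch_sound hn hmax he h
  rw [hev] at r4
  have hk : k' = 0 := by omega
  subst hk
  rw [sel_eq, if_pos (by rfl)] at r2
  exact run_sound hn _ hmax hD hconn hc6 hc11 hg11 _ _ _ _ _ e' r3 r2

end Sound


def cert80 : List Nat := [
  29]

def cert81 : List Nat := [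
  7547]

def cert82 : List Nat := [
  2568150209745040494525076966479168702085995]

def cert83 : List Nat := [
  18995801960714412131207984380990367581345432235720624776134512787545791580959892891898991764239641977029515940686683,
  2124363406889414941]

def cert90 : List Nat := [
  29]

def cert91 : List Nat := [
  7563]

def cert92 : List Nat := [
  60181008480790182806047685764482868239971685106892240207294815868523396199603112062178134907]

def cert93 : List Nat := [
  19872680050160299302934212624325965821684058947406251380463425317628209116048777544218279251014082816393246786943851,
  4547342531399621544558807252886773030442711645802110518393356210832248826439911789167310918727344528111695356235851,
  4954148079617020008634966322303242721559808115012928945449478278582661932877092796901036873740872524232303198620529,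
  4954147931593853542657347591534740039247825406967027963671460960809122883590597536872807590749237474607490388733968,
  21468196992707870663682513227418066297896683863959481506153813927022511329524330133647538466660338502494830602505072,
  7397673117440749635492434446013861495676547517060574146126497576504811863123248765709277134287832738230593655636253,
  544994415666145529888]

def cert100 : List Nat := [
  29]

def cert101 : List Nat := [
  7579]

def cert102 : List Nat := [
  33510786867608306157689995242588039498887000119473443467932965301155991716327227526463052936287432954490463140551563,
  7947278769]

def cert103 : List Nat := [
  22362703684466716044313418312140156045549713689548065419682703292910667402546835960517864661784991169633862471617403,
  1396055993499738857376461689811129799764658621534161108995772775116238790256135412767991865189178463030197741101104,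
  2772271522755086257848089905787190614207694788094074824568327384609849904549945497130664509581666398363177348020659,
  2745628819107535310415849186844048283504754619154745465717978039790360283243333659661143203610984292424259061744390,
  467204279424532879649516612750973277698885296260717237354236928827788852587160407201177734145297196693634208371894,
  8631640846690798418163706833990095735877258489051604752185674392213788122033403866049979062022716570783661406094258,
  155123595478034594018840413215335126833164932729945586216399525732918777112509886708525359880597550318944814371848,
  27373693382991564273168332056338530728369216116300736295912452840526004300317069827380708701171161382047960723469571,
  1876176309019671644775539296824651179056837645514643834666221919973491204945925975195672727725069338190412607848708,
  3959121066937126472483783878626798018510108285988640883773452575585900086094424460956605082696733593974943062181223,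
  309037728565299859745648502124904169020358235065449005532039171363481659901612070835548560907403156635438758238264,
  10399087295258953579820784496300921168087614437360177893773739450579965526398767049322022327287172206417051134330404,
  284814098393479277007831532642333946383971195528575233262226021385919279919293676605756267259332097628376118696770,
  309634245724755823904290392077684812451115388178820042162946768167917020368454176009560953476805562353937754470409,
  27811561050221688905230357100308634072614085042239372652093816564397992385684686560230157023527510973367802627425464,
  938334437611138177385203067712112806628856508177830477920417793576254814375640357126379503224248130983827312358936,
  4954147935737696232798939344523096085944148844821160201286944271486960211976366432271365853402692379384316771742472,
  14785484832048333344690109931212757016224095115308677669366494991210072671130046495010305269823615640965563416588304,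
  2482128226727784941528279275819607684924738733598684779341109528279701776338032674597033686823579768050235482151819,
  9090663624544597626620787992888424149667903148403763102140672345495283652402524968368191964217366507598398075445296,
  17248260525483876102983548347385621163199564557434340570196067537808388555977737033132161379687812054691402939900016,
  9860159831853651362426951932127484717240157492395398521342551007865499842045576836176208158840760693342535837294656,
  11630208770919592349877808955994051422342916509870009973082994568130630063959662186390765554085629184688000002429009,
  21423227222445572690858697678720726122721752727163572164553092532346674629882415784273748413945339262319481577287696,
  20403502931053971614686394692279411680360341852399422534423735424646860592174675277570320930706928707526607259049371,
  21439300818339536573487495601773513255328330263976421467690722092173076389310005988940531100789192885561408458955652,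
  27554318622441309466223685522339078171144329671401991174251945835830531046876425785534324250302370872128390076527003,
  156736683518146013197169949029570260115365331444790215021166717949702513812923601822210902280756425544207804401944,
  1079207049011450975300261777967683543571903036043324406944935785801448303666284309231631930473683856815896211292675,
  17267312784754403007541527142677280111905475159593447693895612252122150606517336296597787269969466556243429355356930,
  4557026114878572314722833582827649456562812518689153632835082002301200328957016388869247804080629735173248305425291,
  722681790200484448298990244517200606252525017722347724489465533549703280545199874436243640363788340774535942917009,
  28427813935969782068566569793377484345463807637816450138588400268905106522627866153862493460107194749559292479800065,
  3185203174743009348352329198463552924322505047917001904029870493354945108393595785249391878728828056061592127255001,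
  946465236052527721768494770867890172559129262862316637518129384951519164738300123348768509446535887192484851352328,
  14044970864982414503354947502860065618542318132883609530860553354659764609633194998653079644082318793587177061138947,
  11591730253292884222508554026407291954117555693484923363217004059677415929333810389173658945217529466266639585722397,
  7397672203976519919044162745601350037216973325552599325084573479925018741261351529552208092362750882108507434287451,
  5880006204262653353816531939842078772336817214695508192907529203324311662142975315703793004372523785616443247919136,
  27373087459005211392434702531278239273439992529123062214623936463162232124052798985803297783118020942292923951985846,
  8480126979644750573601929703397951469977372839922111272220484424855569772387991547242813192963136124185503007441156,
  8179854674504510682692795261286425030576767858392150599995303602698119072199906450099855010052048795860418689439527,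
  11593609554086101039175088945080957868921666303044169425740177685403743710874763782964664500926954990320290897396998,
  27555479968481592828394429433251200820933677609882882240833159471901616651740492853035163230808707149766748629853025,
  309634245724755823904290392077684812451115388178820042162946768167917020368450176758178638307809910978167128053942,
  11591730252719509568511050123784850680641617583493729693916062378673322713782827919193201008514141768954978516907192,
  27708864045025560699175370474495739222546040325592700750075697427231003161853927474071288135507944254762484816179547,
  466600677630138883480441731659268231784290692119549837045639380940119611347650959861651686016862948754632010367446,
  7475306045756010380400353888752453453474604583972220645403077261287031853044287616068756871934967096944952360613122,
  39354043033877852181659847897264111747]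

def cert110 : List Nat := [
  29]

def cert111 : List Nat := [
  7595]

def cert112 : List Nat := [
  11561394523871588810076576007850168222999599273271464864442785246361408941380418695415603367481509898421939321285531,
  14071269394650429159138936752686442161355995403463742235551795828305527308594938653]

def cert113 : List Nat := [
  28014778174505849104877458702066835560598042330137139339341440576564948360327355776088858362754997546131107510721419,
  4184640957391017224923836987432255122296972235500451939300588595692149630828925313409240811462725552371158659765940,
  14051462086431004850968346758866161187082589586327308679493694561219494960577840292274767645175436726074004530666544,
  12410113852014962749413611834699098628109117600095037596124758018718056133038127780590524992647651493243792396398753,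
  24825329216448994750733958154076579115513715628858548768513644101847572402965940963826554620104050889551266799853883,
  2507786497486274548900706826498164380050439373449428748053294785026253403726091580603377731637659884492747208081472,
  9879398854168569654418186899825128829338544871906645201549445574027147081629647958795273562398941752718184079695920,
  463567564102453949491464837399957961959653808674060065612532970703937414431717259465344590688534861344896962112347,
  621115991272375448366865635770324312065855648227890467912412016586611808330856221475785462207332772049599613490612,
  6666656525343383978221455586604400840861583872635207323934880774757983281359970167128685330951291329752004591662596,
  7475881291904887364047356019632150710530069031451625358934609058023538424395102467520423982808487156288968302009136,
  25116924116741582753210592822976014241989714363570662112668144999504544475072149830342885777240493664608179278852144,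
  14051462086431004850968344683246837972573200678347711536463640107182232664683039096983708830339300318934070770625360,
  14795105353883172449741661739912434087647879970106527728268393368866377873780091908121699180866981485781012281569441,
  7475843715223562948406576921791546348462466999681772729171485768209642729653755980968204711819622885144984579961163,
  22346748034674924220253160492509758407497584118950483052264774790546345600889233395262513860481317241765850230304816,
  22405668268435868285720030119414683742850878448535684439987178775559036622526834981095850863539496371701130665930898,
  4954147536637233305704981923843387733807497349778144379081527994914404100098201316955192217488331250434599877842240,
  22560062743911968432768084126952138298221803060866820899011696598031724817892459807900971398683123416873178756053856,
  22683201409349300374670688089357206233985517773854262120991102191294517061443109227767031086833747341535174274083084,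
  1187248689005586599820915420518576635324656561814609813534785723927992133086834628340639547636248800430195916630930,
  4537712066971752193925069975657303473969154206913014971782641427177968323416043845444433520800095305659086103773953,
  7405601597588688108914812902414553852848471128812969296141733590394518887918521642073830258479481495002667401045092,
  11601349879662467384244222202567722779281260091906556253112542381774964867801860279146383496825736700495702764911460,
  17456799808020934757297425742523991233733350750223338314950633545178657703650302687264058282645342251698952507265937,
  22694778211436149001484977645029612134342779940566316209793960995108863129968650238625731187624871604556250305618035,
  1089440108414572584210907147171826677935260167611442150713448781928283236584475694573315345935979814337995093012843,
  14044848564523281552080392688416901034762489374594681262633359500026465274473179526450893246623134003510413373192020,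
  6005491577070675062465108240635070202069891066810719881192070167216266938841372906568768275300962676433188939308395,
  33044538365778146825779025064464578305846135709130646991887150052799536977655991859838429435419597550262961204507658,
  22538933519990974249080941724118180123260775522982459283536126574895755125142792588486059023080956972049328111736241,
  9938469195024480076588120799451216932882186220253825342594311236760810221547131039574917998097791105237942264672401,
  467240232201472684275411057611971646778904187299481583291362394273625020402789517471262741100503195273660438622256,
  4954488618700704359077363592271360847060643152360693092788272297815195193502378541576053187010091569447445443379971,
  33198447685056528166714092107431341182144108698717068819146534429836054764582227302990136227348079703519029201358907,
  27861472466978251962808681658886325657769591083396507869609403164574720710489878362351028267208983671732586169882033,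
  28013573289021561298791394967823857769087037093269552581358152211596487630481616033252700204164143363105048831141123,
  25293955703063197543327810183006932208023775009292031519643138734321688323026090513328209190389970128796532836284948,
  7397672202247775697733076204167211620274382948075597942717697212466199459059744770029351777632093815698551170879536,
  11582376155624477864640556967263192943023824278327998880381118435203587081397401766526848007210256995415477177765920,
  22356367662533791464570589731551598370961065710907091620056742389842725155041175535350355561212139622695621199303569,
  22519693670297112602689767171742402562556942269487841081364875532891569277884123180141968946726596934379889829440320,
  4566683323127936326376501592378802856483285047667896981911284613401735811075124322058248873071568390536212918579248,
  4954147931690821394263332480507043493104909206569091353053548752626458358131305507137020726176071937682141822524763,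
  11561206072535537534564245085448908865682642907704272197037630519008195687324809663283257053526491387844123421257744,
  20180583754864612520156340014762051505154770349326123663446348082712093207202225611669969124673496491631632101421072,
  20180357351327152223966431655096361995553961220702569945727489443325826821381482857844680985790963747889565458447204,
  9940354711967656853015740018518511200991395547123803974335964603269781395378521212863452173216581362457509362355074,
  26378874036173326060342153054737866192542936987269005540717519481649659542424614951400461162175234568852549573253952,
  15930570731660368881632095886481975180278153355610635333209533092528087650100256227407788188487598793506533061447709,
  8486942589801588084996916897564275538957606425900008010585565357355713447423071915984383165293182052560725289753493,
  4954147536637233305703934889775265064829257332117457980821016889462520500919993201820019207612135692942652668785671,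
  24825638364591828154960665026751816740986738921535216046934254571893606456131480340775359089824730299888610564922176,
  3185212581717735857213705367755855022740114494397788408786579904090729169290294585082443037137041451439599168627363,
  14024019366330994923643620403591896793609269882671261273581228452059638830880109158598757692450612907401419215743546,
  28353353714657402242583103427407015132250898086620790579306140803320931516246589687227162004519180104593470265203563,
  28582752572932563993524276187056702665209240759528728693876730213162472691352443203690100709993949280702364165612804,
  10135907469562829311268868796950045564105876117912444166843929739643124071525459782052530327456988111602917763921946,
  8635256911412402189617933375496272821754157955243984377835877785224597430229294868476578223794256887798073084130886,
  15930583055687609278505507245487861957023881738767580613600274667725738357461783327127276285988360235667309851817767,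
  1552649796955711562831560988658033427313239737044023883423092282499695667190202008476518720623514458373566509507217,
  31132412108029875431311907511874812117520889925905913348768062212274228963214135930617857687385564516350397725737733,
  8631034968635730060376740915024756142863932569526198034237569279272471245507508260434430511916944775461171366221696,
  11592008309229612819823007826147966418707622127566900523896454681180441630742577167407824514591773736458699851368248,
  621868278973986662879182967581963171307321537417391322750728371434514319479921742363625279689783825501448000192555,
  20057235931502210519668093775077147420764503861180972802903983056705783649749873719680492310240246124753232044819717,
  12946621679214774447295904829069426736082844783745488948933764140453596454735969678001038149393866559819866742424434,
  10818481214964179725727192354296399296843845815106158473800840414957468802070758420376959882045871432527776811031371,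
  15255332667293422300409392166962494668831297984930390940254172030177006408796894393950044494195772532503050415364790,
  8780587997374662048508451709481298477502381028600313725687575012827656973074269583388291427426359982547439892250731,
  27811466450877808060385620083961881847222743008532644237200360497701853801881910114383288562931182676413211421706770,
  1946449935483419112235578754135288127967735810239187744450807338447525483081435897709395834176258431441762355855834,
  25136233437166998731422476231912815630735311469685126373826787321699929406452313065595096806493607643270679843460969,
  9949862668335241457739754201762181680928597551734666521461734940182748610960923303509663344827679164465394735919267,
  8159673050478193228723450210164484183475702032057148431913345699637214373644611249970717359279883359187965815509872,
  26364674340259848556317876060790995242754222711782245061712376210840175561782271553371896500140348427884836486842938,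
  27814123904769011903177509339226669291165925028383777077259349820985385567557627964739289258369254604343716236009501,
  5726734836322616780573461749893849140374100707051637724132723480157766783876436431347045419028900779916833736753626,
  16523669673536601205087161308435055197949291167262142694372107735435885613920630904911493472608972704620164126414005,
  313250251907339650272388858611083861351634547035180969822955499392717533942127546158411573561840812469294310902557,
  27371272366020646441965708142808852155612727394663792281757586293587768925186917754682336017922286969515402546557700,
  11562908643207751046093790333953110586890388350553857851649620186341502509516953204797249242076192948804353261764868,
  7442700809193725942786283735301514307725903105546166913197955048379596959809802274873684016605043039900820676025755,
  27373677652452150770645378292710404121931517626051506062287433413669869128640829929962787771919465369956179810926635,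
  27705745115515805020671225445142427496019159754949364533955985422496035823646730638746366118651814172685872817091030,
  15394431443875393574021099561881877110949632710936062353935026907781086742307063451339051643895919749364196162339077,
  722584809110107576310664614845632728183675648038725737951095003305387898200161184850743990842977123970360740465001,
  6499323166856501257065391612340946538302705582085679329124879399386090118850156312544096753110419680729014181430017,
  25032460836757798818860584531952585271952932739886723673034325856097593968303798435651749354020389365064471411309082,
  27373684698049705358616452005093277403180066668315078992917564626393156570885052388725868040128550120144305913151649,
  23895313592751083931234501367073551737349148960682513898284617930634702246516293908214256236705218321551338632315140,
  15589241092912047181192926298006945595246373360352862615307132407874973447831840740016716350974018070310664774828061,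
  27371882641287208984355267211314266244525346650761086243496343632255414217660886458718948740671284465134939146617866,
  24835056483226336554796460159399881312294366145442393373790863913481877566349937600153673253965062159839153568811540,
  11601349879662467384244222202567722779281260091906556253112542381774964867801860280122688997130158533062272143269936,
  462354512640485980286028989717981781993878645079481374845676520162603022401145737262170852856198115985943442755691,
  157344601056642306407710329832905545930523000873797886351992002520008395042059078316439986102798964613180044915970,
  27967276487303584500905628084126189212884063517568829229349552111455340993422520988992372187655263059335455923307011,
  27812157589151118330874709791814685331144876700753432746235592760625567021561781746434353290219639529592479788872154,
  27811561050221689454179025331982525038916132730865449548064281184336833636820868554935001740176804601360148059396793,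
  571858890893934723985290746450322305283252710435454674954711150273015129927245297585136156534895798400082694494905,
  463553023213965694148417696628976316801489285521497472732506665804686258605686874966465497646230282749480329025572,
  23876036788919716965524362166082317512686143799083424364694543196660071368157199690992171707263251531402994283675845,
  33664521380775389256712679367774068577795536464713343123872493433302239288422380226411015092010808492115384882125068,
  157342977331153486319358836236307153787564561605017562049861842157355945657058590591206939426897801615381741877681,
  155123595478179381633071413908948538440753273442942879568714979324370092133878563060986891800238940498515023213571,
  1092445955085716710656001522442589508751710637638152769302438815385486243067706255388675266697771951054573174176003,
  4954147931589340275299783381771538671492977422909886188787444654234641590128638028606433480950310555882426793046531,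
  2481977527632822221838781180589643631688769853936714811241173681129103127074345658378825579148584876271757257562960,
  7397672228226942138486272190190402044444263749542030875330654424516873344051215086077631860748223148531174404541232,
  9158798234501732431883775070249601125727269261404139972342464273577133911497581653626209424414438033540948744474656,
  19034355636900049117354149543250387511478792510130616716563596065793103248020537537326655437047989751872091070901147,
  9149136190696276017373877099482664256782250451023116342779715780433984689388344053741168969880295855217959741958960,
  20486919785462609528552125208764031705028263574385987387504681325383979631887676005313846932429506101559699676693056,
  7814193100444493524857693725458696849836497328441827500199471914944452237880547479634422567020275093330815024369728,
  620180402862640805056273029938714911548243225185696967894634228854614687533642867704362568143533688626868984510565,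
  6190294894757259623687352911279953973863797835100864404810069328676455428266860531514652558772477951091492988912132,
  5123083342450195882800595082278286415695486386089214123157417067926794907951555717075745485193079768824875734860728,
  15315455826389978891704612411115819492426643232018293186328219710609608183850223160492401127875457609443361751050282,
  8931889564069762741304940386064872355240525034007791806292078011947580546338952182326671415173057858742900955824277,
  8481341947534980333099313652943147309643188543188776061344922716942107646382417995470961682775385092470655212500775,
  1945773408433148565330684226853553551744939213986291567987636077402015426430897461077042077188106392143512722539447,
  15662564369901551132361910073435446468647602554366539419607549914998147155537631895713029278985135981356327963805032,
  9948884935704437027874588908259209322907277529435151774077521587189743814207686916525996841321833479465506353949048,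
  18107309263730269341140777909188795237657880165472652676295823667912099695197804446943183071111436600561374551097427,
  1574134185694120627202649000566833464351825849746932063816920544107831942744293086861307146667827261900587665469573,
  24704214436508334690516401162173693140847572150122388613115942657424273018740284747571982142366974780711064177374516,
  32736717228865126150631283148147581331078825199953919414475010877178389735496297677595045716358185745417219447936084,
  33664927670911633353032946635009845245031931236664128677320633178762261161507142812586108974375382345831672427521841,
  285417674018672034199710062810814684733714369613807728594180195948070606266971491890554066003959371212779019109553,
  7477091438509810782902982895076761685423045342703385473575604668748873267994028384905837396357659643867448701794570,
  10818040703421743897006686964577458010560287510735887406060800396226707799869679162119482890227482864804282656205723,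
  568673107512556074809569187923466909944889148619478004308462969405541352514578270548714693909524115000890136873225,
  27503552369349992679841891233819883857545268445279126933520919440994846417474086811290181639884505176141455079813814,
  8542697062761891725673789145246626246177294931481615149523670697070249412374006923101224711139234668390850481362356,
  10362341337727120007339939525814254630530234486364940303597093355251011047264118446048692951395549075654644617732513,
  11620627452244455894338399211397694265249284787169764724388918906523075952181943177140072700692557889693219079497315,
  11086680475432228530791805440285759729161650360681917306493571975190860860164698091099024855399704844899502271791451,
  6042956189953919916892212920646975710145990294729516338448377135286212653808223404628771171500840576388449559922696,
  17742400262114205566907827742541797005212285254164084182047343864431921968125196754199481756135684104128495319626932,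
  9100346811844348547517763480500950790632157262621335627107024771776714225708855610429144842112172848235253403984448,
  28534928956002074539559282894474152997970913309458156911848373459885361900795783144580773019473892794424760584051792,
  12400435188411996427306529584922398950116571683170333343807916523964480713099564076977947973574018064617818631147721,
  5726810800419019452895225706370288478447980800734627553902789582777454718153705136456560335377660717083568475169446,
  3011404651131089948302457433705099376210168012708787428019973496542979485658455804369805532177978546134159841342902,
  10807717537674618829803780422827936945721419613657500212002563676601650312866883225431638869443736985715440087098018,
  36126582441068209441951832281250708123449275381468117814328669970804617118325661335248320256958624012551673511724041,
  1080048819567890857632733475273155171781563678848183376157599761823208695409423674395510020183212800371021564753754,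
  17248035830265848574573034298070408464702592896422619738011717070618545069411923590954430805497207902536390347699719,
  23905130088492982025733160462616620520306318749023482016578091074551724836043294305440687156545172170876700935065713,
  15315455880048087210623070053298454451327311325704151335475328383489719312239067608734602719121447386577733765267883,
  466636656757699260195662460733956954633881098520544064195196568438614902890946343156420342064929401704590237975107,
  8313188338131732856678920554181242591669941708327877033481742207284996987968393101499199416902346417523914028921603,
  7465648738315035754677709262192656119811452958942462921230247008584619544994451967497071524417138239878148424054278,
  16270489352645302820260112397615927106150247387723438201923730621926486817600097589294859871364414057296450855671360,
  775064775954272354287275522411999130885758405554311818106216807624195181994711903499933075945426685949865824321735,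
  23902001800016562865136496731725117815425192122228140640172352568937539095535352482121956193879466371141188945864229,
  14845721437603040012653032592843164064732265295670251735533798790334416702266234633167162969758314587207554946986865,
  10961097332134183588234411857394281458733830781506714071221063767509490142638327129791697136196998747505443993567280,
  3079310420737143731298594306433749141994660926069638541242912335595561644884615587363923852647166494710516487403781,
  9879473615421352198007945999627152458409645283281476585080000519543465866235420484080279249180674298082737229202696,
  4566506638875056023699396120880763860522968770026809613382569798595434221204838669092507775661854028141519722021211,
  14035116082681762440933471900431157613276564323813676760688060662436048299130130096448628094825977044324082290528331,
  12348905840519337892293271249335582130467200219928188864841967816511808312903366272115597442396302316698441887002640,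
  20087371421327532961563004748276571188037769238757228769778482782864287771400615528201524150485633880801762861941122,
  621269878292862238688946795070729716166377795447199654947889020009319010447827791300818059917140424931682992481124,
  13853382716269265629944994363076169224137420540713937517876604939569624453086295552504548849478025870348794583285956,
  22284490262530220842277897872312194745785201484226459651849318196691057071272939276369841158361484587861022026152281,
  11561356944218510978271949794741329979844317619214348839923465843323188077759236399669301421355605283146992515261220,
  9159399461392163444754231818419921003775696878976329164783954292531045621640504599676165773484916360705922228563984,
  20106278328566140563854002540132429477302819961342498230013449861313839183920195735735569389283240180389653917041232,
  1437064057394816255254219137532352118273758552621324994866415505402779588655072127352358319248286219284334113940610,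
  285417689392896260883716954442000005371493444660475530265126589554569480408475506949711191547033639037714380669956,
  30941178577151394774934774366584696400657128244743761202823615547145594285182731671443458396906507214958305375508826,
  19933227533573438657040385873640264205924519741629906538244135850785812804344887669503774800604551317052456182162576,
  9929570522645329993531577038743090589974257300710090086923154939658357762451167381390375664166514697930526586274368,
  10807717537674618829803780422827936945836307077591303368817667182697940317920095503067000937590943948174367606129452,
  263944958231736171975667114729598364857691207054117020122781827046546295502983034476312759173104001092758827746569,
  17615009985209595674524649954862606918547221949751813082427382822788004997410839361823636009672332203957653605845046,
  28583345808101536961915953285982249189829300018697462992517052641696863032859505544353472779330786180106636966445104,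
  20057106769718924101328898274208809140483516620493536532917787837852049129353244648886939886958779990857231891739098,
  15315455879465715390153611485987973338287698799192186303535828698623802802607417122240643514141458794610174796202832,
  23911593136487226935720538770963507209419912926464055996220288147355210895626540851887949788848649759954671627156322,
  22284900263871780394953045857866249036542337518575134064708469822084485992387043267982358386107466217926571852504491,
  3185212581527749814187450557618799685691620267209095489148794778084967656176514684946365283746536181988642920376165,
  22831893966008267779531665480980320194514559155295378116338110273163524255433285473299280150304840649809195651705402,
  11572528569170437731918381170602640737790378627222209480403087416162510580017862392535681750436968156921803128393776,
  27860257719926703804169037749784997623908319174420536612442221104378050894795324875492504406271750268136428083294237,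
  5393066687148173513190843475514349062680995111340184954939347967139979705627810714939739028622553739729562957558233,
  18056235696219206614902224390574423122845048096897888159578654719194824920559350017636896897155223788114641602806282,
  28524628345659577679302917447872740812337139189603163050316424434350951572776979378758697066985716501512373386582864,
  23931022513564270413409809384923764854601896758111482837115560376197317100895398547200782429384675295556645172664244,
  7397672204549894573041680623504055261042495060751740572376643760859415952507156331116870435516325652756001335560989,
  309650832306324600995544974454325713721207481692587329050492831952391477412866612388334545486657037819149554520096,
  4518289404113184618778516154712426747330025007152823329831594072090588688944994614743886553489944913346150318585013,
  15162569932292965284405092353668599627133865734973134767377521476059314818580652108928584168992872081409612050366795,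
  13443039774429509881512341474939828436510652231657557752174247020345285635639029526583679149239212781874623842103344,
  2507786938996537496198880657289518468155143459595184949624907223779422094396634246863302611882371737025825742502327,
  33509801743928298404039173427917187051290972376688900940020458308819181026194048594567033303298539485614111996977200,
  8634652468005703218763576086657336591380184700270686131024425425925097165368368691431944685670662648341838584468657,
  17251248771997505954358792213989821630492678545511153020262361497612814812628810559993685228906334510577613232388120,
  16014318509980308123914500855543736346244906698143932092221709139018298088398892439087423458352306549712155790286880,
  10971964121754969931754342857716063426756041844440218311865557867785146727427478976926148825112638493825383957465365,
  14939324062503015548608576818764063479849451692368264616950724052009063919217819410873545294416374387695489482310665,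
  2536765376859587594987739374696132840803945735323919971550246642592075228881630042806348752185307392964300214636592,
  1934951324068986192185792039381963812169027361194795402044040095876674444711829251483327927434319221819188308086832,
  7397785498870693550326864623126675717958002326871372764569079331735210815907300349846445337971488519022940483294568,
  311590596000380166546271839449973903527966579391637491203637547477450245763109551578425379785143643120573424341024,
  12372717933714759417517176953295445878145643130072100564256989667333293729830116164414436471327395121590514108212802,
  5546980782883833213030932317201385729757681404534493863414509656752788437103319452234297380940838161196149761330331,
  19021166967798896078250206860784940799788513039898973660459576338400263208811787389505942780597725879463060673510010,
  33508186014708857770069065512928676573440417819549339224324114847393718506083545986083541877602467663057931873635101,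
  27400134014045050424199049749016735809470268545608588182815832452828640558089007498743982444886906014456422659589297,
  16014630575561683984378880046081275801390720315026194591785315818588303770990115213800621524165328156789953450412065,
  19893704551805090751675712870537546035226491544185155747819317811655286253173808878838349657358068108875050440546629,
  16014515038271190668935078852695287668048572865342362849627409664425228453690588322092942781830358045586793078424896,
  3185205514111597658225270532735337845691297290477748605921465056620693553041835384667890216885506883622527480383813,
  722584802670420399248956407919413429806335089138017990552667918241493502478026436152923038533859639236626367121464,
  3409083586873168632232010684299741191063648416893405131435348557965047184480259623232694924599201016079638733128449,
  3185212581527012955601443516775355287808860890880331603298870532901732465377128558721522925510318452948536406574646,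
  4566506638875056023695226292437136193721579752713073352338269455409725761266161949566346109590969620137882900899386,
  4954413465332018825047829379380407672044539192577302814445151565591570695808981670342633839980056345180768316690507,
  33199753811120399300220921008316724027919753988463103437116879622973275344885371097324307882456908562218589257617467,
  20240518036287003242864262424374404489842817087961704757990071860108862994914106582837115496203980312884039679858097,
  17325899852602918352148537015459484106629159797367393568499774082883028875121087071593072426857224861677225688203600,
  18950784805031698424019042385672627232460026377427090535806190269036298153883182992982563447309851519943000696380292,
  26364470523464964664067632589842940169781106930735348017408267256777667367734603963219474185206329231788218904481867,
  4518397039359350084428375828385426064734123574653964963356905459816547493302972796011977209357246131962495482474525,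
  723698754906451750553357198816063604639975074015353474352463669202324237615990235336528272713393645203502327877712,
  33046258171439215125625940227212130211609322677998014919750978916183146295729268083790280301112356619011759049804071,
  11561281790855932754445053080843028848744540881354186090152094979562737607801105549171029246204301010606850126034433,
  22712763726601535074662494000191399668827955412796177981834809751393673957980811487861954721719363525525904348426256,
  4556988147281323069948012092451034649256141472092816054833218242320892834948840752953398131246655620726616677716370,
  568767703567890769060918056714929682951900995097463822926220984004139710519682464069456330019033326400201375292779,
  310428910110059715890074559694180558926829874158417171097032262806810249577640194358959485310046814722833552310793,
  4935009264270971652882207266447086166897885710692631158172405902382286979624834556771840597609703393766376835580930,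
  4348136948744368774229045747074311065971768023688531384153937870877439445841058386432548789224250229354299400400912,
  616768858923923805406701958669601839656119053720824862714832296783545679736957075774595957081037009530312546673714,
  15903132063566934668994053901737567682520270053205107579054830488305894779633039679981474326031513412815366430775733,
  25031603718536668942516647301484990621687597860915773322308340545578981859148300768684977486792444321955349797163072,
  6666543033859949921809448635963214939952920831603598295918255448549327854572875727472078907073558504199510962185264,
  11561244217870746817806698601688438624438077535194785661617942898801681088296087340982664674767189206574345889161840,
  27371272338324759119458763930367658462375226277073100107068676712983886762596596644282635208520234903911324224339997,
  27966682343467380491212361553590511152908077068623048762370761800095343784804477506858226742294126439955108060137748,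
  27860864012115728287714823407822833480427742543023288081454710656447332509222674889853209576160780705499647231439318,
  9908288426275638955044817086852026935804600829247344592761725127984185159797843008116285890864586612808491380889012,
  9889048867613517728269219387642098156631082666402065695058052822484073963596179371713154474667564097370751878843195,
  13276972949876193681146243831461023116194577090576964954652815309037251356920281830502529170165974542952440509852491,
  7712576706476230498572059866117418196992864829875930312148662741133016807619888118920652682965407388600467972956192,
  503457333211759547453721863419829565245964558757661654547179275222711753666011358112597992427668707913062466782869,
  27706957313814927350885267364070120181376120166420785129181350721186598617630476918788918938573422505662153287205378,
  23945908101974436618665357997125449231210973476879474316069292353659914249032279384281834551765315981129384886481369,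
  17274076443522068117983706838347814465334896921123159447189120463014564834850535905630249355124834699089188432468765,
  20057091969745575069932918243563944604958276152126610085940630363023036539381667613829811016364935197268341800599938,
  10969391932046831275863701718774176084422767598146377318652059497452898127024646871309188313272979555762919510650944,
  12775974678469838412518084491673077639047222162916951878164755862545949769160835921413416312752039540254039052091591,
  7815559942981293134176379481181973616552143307059943405046383209946610824006537646914557317000835108538704291345673,
  4528204405839100121430730799278095290727641589725940637095617652410649569893245235328926069801523779563142544835958,
  17615613053632735959859536505405611670816728688789868548142708461261107693411579696321373451665594829087206019898715,
  23902113942234624493174715317665821077827471605741511775752264985787573508985670936780872145254438646205997766099057,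
  1243764019409973025921723372166839940147212523806136411537573426092678035372486911116850685326857698800723382403969,
  23901851051110750113176185506165940683568035542512557105852679023420554814134585184775447415935097588091166281413123,
  25185158819148224375124905839933358595585733990007844153047065111919675951600868791857333868956938906472735705174145,
  25600581480271361954905769169409564708869278558055634233143465493486427180867498564170459358366249674547385405029282,
  3718118865275140304633907725950310338511860904665001460455334342377919813417446190638069308069719114969657331372155,
  17267274474151261532575620581897856569145372873450352032974134762876230161470427938430717229547087800885973447431176,
  27705648118945128263848574747408706203563930262852325764151309828375985095419586193674254010699346557587848676550236,
  5197610560746744172464681802407603317941492840647492104126792263028747205901551691715492046593168550819619866653145,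
  18528440167060424412637235056527320224825808339308832382248361011172709319259713833433258956421662041433578938578021,
  27815997474579904079676931269765155141369218461308399685824222234441224371292360686726982148779331910214419330132506,
  30430514862565197498407419231693872002809920239970271713919853812760111449514048383422508311861230260141336454185429,
  5697042957239324658410720539032691136542060450172492556242766311749403404115021724439001904588145789699196086278433,
  156135835546588021557236062866151060207145157966528526188205252152420955174065726362402499491807483629388070847242,
  18986509071855573665543247942937549174118324499764178922628413864602934455980921862006667534717310931120180649197826,
  15930572337823491905791610555346224244465528666393637939095043842707623157546102276387622875752892715323089328622365,
  8477716977738207689604492161427099093522431394574048219894568842808969898265346751312786600026014838010275859795093,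
  20509402642209614624764830865542239266482625120343586079537819284835284195673943035754930401947053102638650866906119,
  7397571386543543787883569519322010480790697354150436591640076178204808048679075940165004124157540644304151514875740,
  7475230474803417675845850881197607524478851059625248458815804778370825802507273188534383475290568693480909330736228,
  3185210189981621030929660018901565608777479989988553038958956695026913756114523895080031988047068180223908284944416,
  4954147931591613692984714368336003338614344807860669095524870030460910446095638316176024678624111164026980618470406,
  416064749167684358821465146909605824360047847132302650173714055190649684567315138398324724162698656419704604412768,
  27859659202316894809326373208945894099801432848646606148211753218994817004976118026102688599179580953176970291773875,
  773829999200490912350229323304719443606265667332661557427908527708395616732184888946808900744824322173302776858036,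
  27860858946899705719135466922970069245494020864408075082024552190837442228658878655408898464266346726476434762957749,
  32892346433355122138574973154023262821019185884479471965072881927077968537498178634663135040121575439976344147243481,
  11579180078503219259850292530763402219453848295421207257978939862047094807627954570347952797784540316735835284505857,
  16514050189899212250387522325569932137155966057431316060731752397939553635744875703502255101702211797617249934672496,
  27372483868116867237958302779653523283040922537033842651654636681905346776030673129179869999119386841088302382800925,
  1918266898936268199293908309347287652233728480838609726833335407447657757609793477584177741753240709809809521836292,
  27813367107075333818100521653041350137148902997904617883347252825106455907385182896413620902082369355895197283214456,
  7417118602320587573195083630088876020746898949551743088078762979664119269403349387820004239908712981971603940509461,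
  1561395715804807779461632056006637125391481738992693664208131747521878135132404758996677107731986829753777435532096,
  33049600204022905143927789520325073324825559301886695739416164959571631190867464741533814078723923342484929047038503,
  16514125344525941939187438961060074424193385373680766612643192438179263785396518506707507366198474293304164141937665,
  30014268548268594706971828851811400182787948360570086807666992531954478121079718430304225953876411035821472259006609,
  1398276943496979553439132564325068263056521365613222880067608294393422641511179549541470178675117672752156762256929,
  5697042957239324654210181795526624547578378923333774447273776699910780904961322561026677947835923290540960655847939,
  27811459405205263212181562160580535754191034925912942730085930484582050486905732867189286261018198167670538111222538,
  214714357399865348561092510704093395251742049931340333312110436877541359305175]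


theorem ok80 : ok 8 0 cert80 = true := by decide +kernel

theorem ok81 : ok 8 1 cert81 = true := by decide +kernel

theorem ok82 : ok 8 2 cert82 = true := by decide +kernel

theorem ok83 : ok 8 3 cert83 = true := by decide +kernel

theorem ok90 : ok 9 0 cert90 = true := by decide +kernel

theorem ok91 : ok 9 1 cert91 = true := by decide +kernel

theorem ok92 : ok 9 2 cert92 = true := by decide +kernel

theorem ok93 : ok 9 3 cert93 = true := by decide +kernel

theorem ok100 : ok 10 0 cert100 = true := by decide +kernel

theorem ok101 : ok 10 1 cert101 = true := by decide +kernel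

theorem ok102 : ok 10 2 cert102 = true := by decide +kernel

theorem ok103 : ok 10 3 cert103 = true := by decide +kernel

theorem ok110 : ok 11 0 cert110 = true := by decide +kernel

theorem ok111 : ok 11 1 cert111 = true := by decide +kernel

theorem ok112 : ok 11 2 cert112 = true := by decide +kernel

theorem ok113 : ok 11 3 cert113 = true := by decide +kernel

end P3Search

/-- If `G` is a connected subcubic graph on `8 ≤ n ≤ 11` vertices with no induced `6`-cycle
that is not a copy of `C₁₁` or `G₁₁`, then `ι(G, P3) ≤ 2`. -/
theorem stmt17 {V : Type*} [Fintype V] (G : SimpleGraph V) [DecidableRel G.Adj]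
    (hn1 : 8 ≤ Fintype.card V) (hn2 : Fintype.card V ≤ 11)
    (hconn : G.Connected) (hdeg : ∀ v, G.degree v ≤ 3) (hc6 : ¬ hasInducedC6 G)
    (hc11 : ¬ Nonempty (G ≃g SimpleGraph.cycleGraph 11))
    (hg11 : ¬ Nonempty (G ≃g G11graph)) :
    iotaP3 G ≤ 2 := by
  have := hconn.nonempty
  obtain ⟨v, -, hv⟩ := Finset.exists_max_image Finset.univ (fun v => G.degree v)
    Finset.univ_nonempty
  have hmax : ∀ w, G.degree w ≤ G.degree v := fun w => hv w (Finset.mem_univ w)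
  have hD := hdeg v
  obtain ⟨n, hV⟩ : ∃ n, Fintype.card V = n := ⟨_, rfl⟩
  obtain ⟨D, hd⟩ : ∃ D, G.degree v = D := ⟨_, rfl⟩
  have key : ∀ cs, P3Search.ok n D cs = true → iotaP3 G ≤ 2 := fun cs h =>
    P3Search.ok_sound (by omega) (by omega) hV v hmax hD hconn hc6 hc11 hg11 cs
      (by rw [hd]; exact h)
  have hD3 : D ≤ 3 := hd ▸ hD
  rw [hV] at hn1 hn2
  clear hV hd
  interval_cases n <;> interval_cases D
  · exact key _ P3Search.ok80
  · exact key _ P3Search.ok81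
  · exact key _ P3Search.ok82
  · exact key _ P3Search.ok83
  · exact key _ P3Search.ok90
  · exact key _ P3Search.ok91
  · exact key _ P3Search.ok92
  · exact key _ P3Search.ok93
  · exact key _ P3Search.ok100
  · exact key _ P3Search.ok101
  · exact key _ P3Search.ok102
  · exact key _ P3Search.ok103
  · exact key _ P3Search.ok110
  · exact key _ P3Search.ok111
  · exact key _ P3Search.ok112
  · exact key _ P3Search.ok113
end
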